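/- arXiv:2508.16886 — 8 statements merged into one kernel-verified Lean document; each statement's English description precedes it below -/
import Mathlib

section
/- For each (r₁, r₂, r₃) ∈ {0,1}³ let N_{(r₁,r₂,r₃)}(q) be the number of integer triples (s,t,u) ∈ ℤ³ lying in S₃(q) with s ≡ r₁, t ≡ r₂, u ≡ r₃ (mod 2), and let N(q) be the total number of integer triples in S₃(q). Then for every (r₁, r₂, r₃) ∈ {0,1}³, the ratio N_{(r₁,r₂,r₃)}(q)/N(q) tends to 1/8 as the real number q tends to infinity. -/
open Filter

/-- The region `S₃(q) ⊆ ℝ³` of (real) coefficient triples of genus-3 Weil polynomials. -/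
def S3 (q : ℝ) : Set (ℝ × ℝ × ℝ) :=
  {p : ℝ × ℝ × ℝ |
    -6 * Real.sqrt q ≤ p.1 ∧ p.1 ≤ 6 * Real.sqrt q ∧
    4 * Real.sqrt q * |p.1| - 9 * q ≤ p.2.1 ∧ p.2.1 ≤ (1 / 3) * p.1 ^ 2 + 3 * q ∧
    -(2 / 27) * p.1 ^ 3 + (1 / 3) * p.1 * p.2.1 + q * p.1 -
        (2 / 27) * (p.1 ^ 2 - 3 * p.2.1 + 9 * q) ^ ((3 : ℝ) / 2) ≤ p.2.2 ∧
    p.2.2 ≤ -(2 / 27) * p.1 ^ 3 + (1 / 3) * p.1 * p.2.1 + q * p.1 +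
        (2 / 27) * (p.1 ^ 2 - 3 * p.2.1 + 9 * q) ^ ((3 : ℝ) / 2) ∧
    -2 * q * p.1 - 2 * Real.sqrt q * p.2.1 - 2 * q ^ ((3 : ℝ) / 2) ≤ p.2.2 ∧
    p.2.2 ≤ -2 * q * p.1 + 2 * Real.sqrt q * p.2.1 + 2 * q ^ ((3 : ℝ) / 2)}

/-- The number of integer lattice points in `S₃(q)` with prescribed parities of the
coordinates. -/
noncomputable def latticeCountMod2 (q : ℝ) (r : ZMod 2 × ZMod 2 × ZMod 2) : ℕ :=
  Set.ncard {p : ℤ × ℤ × ℤ |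
    ((p.1 : ℝ), ((p.2.1 : ℝ), (p.2.2 : ℝ))) ∈ S3 q ∧
    (p.1 : ZMod 2) = r.1 ∧ (p.2.1 : ZMod 2) = r.2.1 ∧ (p.2.2 : ZMod 2) = r.2.2}

/-- The total number of integer lattice points in `S₃(q)`. -/
noncomputable def latticeCount (q : ℝ) : ℕ :=
  Set.ncard {p : ℤ × ℤ × ℤ | ((p.1 : ℝ), ((p.2.1 : ℝ), (p.2.2 : ℝ))) ∈ S3 q}

open MeasureTheory Topology

theorem setOf_floor_mul_eq {a : ℝ} (ha : 0 < a) (k : ℤ) :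
    {x : ℝ | ⌊a * x⌋ = k} = Set.Ico (k / a) ((k + 1) / a) := by
  ext x
  simp only [Set.mem_ofPred_eq, Set.mem_Ico, Int.floor_eq_iff, div_le_iff₀ ha, lt_div_iff₀ ha,
    mul_comm a]

theorem abs_floor_mul_add_div_sub_le {a : ℝ} (ha : 0 < a) (ρ x : ℝ) :
    |(⌊a * x⌋ + ρ) / a - x| ≤ (1 + |ρ|) / a := by
  have h : (⌊a * x⌋ + ρ) / a - x = (ρ - Int.fract (a * x)) / a := by
    rw [← Int.self_sub_floor]
    field_simp
    ring
  rw [h, abs_div, abs_of_pos ha]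
  gcongr
  have := Int.fract_nonneg (a * x)
  have := Int.fract_lt_one (a * x)
  rw [abs_le]
  constructor <;> linarith [neg_abs_le ρ, le_abs_self ρ]

theorem tendsto_floor_mul_add_div {ι : Type*} {l : Filter ι} {a : ι → ℝ}
    (ha : Tendsto a l atTop) (ρ x : ℝ) :
    Tendsto (fun i => (⌊a i * x⌋ + ρ) / a i) l (𝓝 x) := by
  rw [tendsto_iff_dist_tendsto_zero]
  refine squeeze_zero' (Eventually.of_forall fun _ => dist_nonneg) ?_
    (ha.const_div_atTop (1 + |ρ|))
  filter_upwards [ha.eventually_gt_atTop 0] with i hi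
  exact abs_floor_mul_add_div_sub_le hi ρ x

/-- The points of the lattice translate `ℤ³ + ρ`, rescaled by `a⁻¹` in each coordinate. -/
noncomputable def scaledPoint (a ρ : ℝ × ℝ × ℝ) (k : ℤ × ℤ × ℤ) : ℝ × ℝ × ℝ :=
  ((k.1 + ρ.1) / a.1, (k.2.1 + ρ.2.1) / a.2.1, (k.2.2 + ρ.2.2) / a.2.2)

/-- The index of the cell of the rescaled lattice that contains a given point. -/
noncomputable def cellIndex (a x : ℝ × ℝ × ℝ) : ℤ × ℤ × ℤ :=
  (⌊a.1 * x.1⌋, ⌊a.2.1 * x.2.1⌋, ⌊a.2.2 * x.2.2⌋)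

theorem measurable_cellIndex (a : ℝ × ℝ × ℝ) : Measurable (cellIndex a) := by
  unfold cellIndex
  fun_prop

theorem volume_cell {a b c : ℝ} (ha : 0 < a) (hb : 0 < b) (hc : 0 < c) (k : ℤ × ℤ × ℤ) :
    volume (cellIndex (a, b, c) ⁻¹' {k}) = ENNReal.ofReal (1 / (a * b * c)) := by
  have h : cellIndex (a, b, c) ⁻¹' {k} =
      {x : ℝ | ⌊a * x⌋ = k.1} ×ˢ {x : ℝ | ⌊b * x⌋ = k.2.1} ×ˢ {x : ℝ | ⌊c * x⌋ = k.2.2} := by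
    ext x
    simp [cellIndex, Prod.ext_iff]
  have hlen : ∀ d y : ℝ, (y + 1) / d - y / d = 1 / d := fun d y => by ring
  rw [h, Measure.volume_eq_prod, Measure.prod_prod, Measure.volume_eq_prod, Measure.prod_prod,
    setOf_floor_mul_eq ha, setOf_floor_mul_eq hb, setOf_floor_mul_eq hc, Real.volume_Ico,
    Real.volume_Ico, Real.volume_Ico, hlen, hlen, hlen, ← ENNReal.ofReal_mul (by positivity),
    ← ENNReal.ofReal_mul (by positivity)]
  congr 1
  field_simp

theorem finite_setOf_scaledPoint_mem {K : Set (ℝ × ℝ × ℝ)} (hK : Bornology.IsBounded K)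
    {a b c : ℝ} (ha : 0 < a) (hb : 0 < b) (hc : 0 < c) (ρ : ℝ × ℝ × ℝ) :
    {k | scaledPoint (a, b, c) ρ k ∈ K}.Finite := by
  obtain ⟨R, hR⟩ := hK.exists_norm_le
  have key : ∀ {d σ : ℝ} {m : ℤ}, 0 < d → |(m + σ) / d| ≤ R →
      ⌊-(R * d) - σ⌋ ≤ m ∧ m ≤ ⌈R * d - σ⌉ := by
    intro d σ m hd h
    rw [abs_div, abs_of_pos hd, div_le_iff₀ hd, abs_le] at h
    constructor
    · have := Int.floor_le (-(R * d) - σ)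
      exact_mod_cast (by linarith : ((⌊-(R * d) - σ⌋ : ℤ) : ℝ) ≤ m)
    · have := Int.le_ceil (R * d - σ)
      exact_mod_cast (by linarith : (m : ℝ) ≤ (⌈R * d - σ⌉ : ℤ))
  refine (Set.finite_Icc
    (⌊-(R * a) - ρ.1⌋, ⌊-(R * b) - ρ.2.1⌋, ⌊-(R * c) - ρ.2.2⌋)
    (⌈R * a - ρ.1⌉, ⌈R * b - ρ.2.1⌉, ⌈R * c - ρ.2.2⌉)).subset ?_
  rintro ⟨k₁, k₂, k₃⟩ hk
  have h := hR _ hk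
  simp only [scaledPoint, Prod.norm_mk, Real.norm_eq_abs, sup_le_iff] at h
  obtain ⟨h1, h2, h3⟩ := h
  have h1 := key ha h1
  have h2 := key hb h2
  have h3 := key hc h3
  exact ⟨⟨h1.1, h2.1, h3.1⟩, ⟨h1.2, h2.2, h3.2⟩⟩

theorem volume_cellIndex_preimage {a b c : ℝ} (ha : 0 < a) (hb : 0 < b) (hc : 0 < c)
    {G : Set (ℤ × ℤ × ℤ)} (hG : G.Finite) :
    volume.real (cellIndex (a, b, c) ⁻¹' G) = G.ncard / (a * b * c) := by
  have h : volume (cellIndex (a, b, c) ⁻¹' G) = G.ncard * ENNReal.ofReal (1 / (a * b * c)) := by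
    rw [← hG.coe_toFinset, ← sum_measure_preimage_singleton _
      fun k _ => measurable_cellIndex _ (measurableSet_singleton k)]
    simp only [volume_cell ha hb hc, Set.ncard_coe_finset, Finset.sum_const, nsmul_eq_mul]
  rw [Measure.real, h, ENNReal.toReal_mul, ENNReal.toReal_natCast,
    ENNReal.toReal_ofReal (by positivity)]
  ring

/-- The number of points of `ℤ³ + ρ` in an anisotropic dilate of a bounded Jordan measurable set
is asymptotic to the volume of the dilate. -/
theorem tendsto_ncard_scaledPoint_mem_div {ι : Type*} {l : Filter ι} [l.IsCountablyGenerated]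
    {K : Set (ℝ × ℝ × ℝ)} (hK : Bornology.IsBounded K) (hKm : MeasurableSet K)
    (hKf : volume (frontier K) = 0) {a b c : ι → ℝ} (ha : Tendsto a l atTop)
    (hb : Tendsto b l atTop) (hc : Tendsto c l atTop) (ρ : ℝ × ℝ × ℝ) :
    Tendsto (fun i => ({k | scaledPoint (a i, b i, c i) ρ k ∈ K}.ncard : ℝ) / (a i * b i * c i))
      l (𝓝 (volume.real K)) := by
  obtain ⟨R, hR⟩ := hK.exists_norm_le
  let E : ι → Set (ℝ × ℝ × ℝ) := fun i =>
    cellIndex (a i, b i, c i) ⁻¹' {k | scaledPoint (a i, b i, c i) ρ k ∈ K}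
  have hlim : Tendsto (fun i => volume (E i)) l (𝓝 (volume K)) := by
    refine tendsto_measure_of_ae_tendsto_indicator (B := Metric.closedBall 0 (R + (1 + ‖ρ‖))) l hKm
      (fun i => measurable_cellIndex _ (Set.to_countable _).measurableSet)
      measurableSet_closedBall measure_closedBall_lt_top.ne ?_ ?_
    · filter_upwards [ha.eventually_ge_atTop 1, hb.eventually_ge_atTop 1,
        hc.eventually_ge_atTop 1] with i hai hbi hci x hx
      have h := hR _ hx
      have key : ∀ {d σ y : ℝ}, 1 ≤ d → |σ| ≤ ‖ρ‖ → |(⌊d * y⌋ + σ) / d| ≤ R →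
          |y| ≤ R + (1 + ‖ρ‖) := by
        intro d σ y hd hσ h
        have h1 := abs_floor_mul_add_div_sub_le (zero_lt_one.trans_le hd) σ y
        have h2 : (1 + |σ|) / d ≤ 1 + |σ| := div_le_self (by positivity) hd
        have h3 := abs_sub_abs_le_abs_sub y ((⌊d * y⌋ + σ) / d)
        rw [abs_sub_comm] at h3
        linarith
      simp only [scaledPoint, cellIndex, Prod.norm_mk, Real.norm_eq_abs, sup_le_iff] at h
      have hρ1 : |ρ.1| ≤ ‖ρ‖ := norm_fst_le ρ
      have hρ2 : |ρ.2.1| ≤ ‖ρ‖ := (norm_fst_le ρ.2).trans (norm_snd_le ρ)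
      have hρ3 : |ρ.2.2| ≤ ‖ρ‖ := (norm_snd_le ρ.2).trans (norm_snd_le ρ)
      rw [mem_closedBall_zero_iff]
      simp only [Prod.norm_def, Real.norm_eq_abs, sup_le_iff]
      exact ⟨key hai hρ1 h.1, key hbi hρ2 h.2.1, key hci hρ3 h.2.2⟩
    · have hae : ∀ᵐ x ∂(volume : Measure (ℝ × ℝ × ℝ)), x ∉ frontier K :=
        measure_eq_zero_iff_ae_notMem.mp hKf
      filter_upwards [hae] with x hx
      have hround : Tendsto (fun i => scaledPoint (a i, b i, c i) ρ (cellIndex (a i, b i, c i) x))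
          l (𝓝 x) :=
        (tendsto_floor_mul_add_div ha _ _).prodMk_nhds
          ((tendsto_floor_mul_add_div hb _ _).prodMk_nhds (tendsto_floor_mul_add_div hc _ _))
      by_cases hxK : x ∈ K
      · have hxi : x ∈ interior K := by
          by_contra hxi
          exact hx ⟨subset_closure hxK, hxi⟩
        filter_upwards [hround (mem_interior_iff_mem_nhds.mp hxi)] with i hi
        exact ⟨fun _ => hxK, fun _ => hi⟩
      · have hxc : x ∉ closure K := fun hxc => hx ⟨hxc, fun hxi => hxK (interior_subset hxi)⟩
        filter_upwards [hround (isClosed_closure.isOpen_compl.mem_nhds hxc)] with i hi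
        exact ⟨fun h => absurd (subset_closure (s := K) h) hi, fun h => absurd h hxK⟩
  have hreal := (ENNReal.tendsto_toReal hK.measure_lt_top.ne).comp hlim
  refine hreal.congr' ?_
  filter_upwards [ha.eventually_gt_atTop 0, hb.eventually_gt_atTop 0,
    hc.eventually_gt_atTop 0] with i hai hbi hci
  exact volume_cellIndex_preimage hai hbi hci (finite_setOf_scaledPoint_mem hK hai hbi hci ρ)

theorem volume_setOf_fst_eq (c : ℝ) : volume {p : ℝ × ℝ × ℝ | p.1 = c} = 0 := by
  have h : {p : ℝ × ℝ × ℝ | p.1 = c} = {c} ×ˢ Set.univ := by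
    ext p
    simp
  rw [h, Measure.volume_eq_prod, Measure.prod_prod, Real.volume_singleton, zero_mul]

theorem volume_setOf_snd_fst_eq {f : ℝ → ℝ} (hf : Continuous f) :
    volume {p : ℝ × ℝ × ℝ | p.2.1 = f p.1} = 0 := by
  rw [Measure.volume_eq_prod, Measure.measure_prod_null
    (isClosed_eq (by fun_prop) (by fun_prop)).measurableSet]
  refine ae_of_all _ fun x => ?_
  have h : Prod.mk x ⁻¹' {p : ℝ × ℝ × ℝ | p.2.1 = f p.1} = {f x} ×ˢ Set.univ := by
    ext p
    simp
  change volume (Prod.mk x ⁻¹' {p : ℝ × ℝ × ℝ | p.2.1 = f p.1}) = 0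
  rw [h, Measure.volume_eq_prod, Measure.prod_prod, Real.volume_singleton, zero_mul]

theorem volume_setOf_snd_snd_eq {f : ℝ → ℝ → ℝ} (hf : Continuous f.uncurry) :
    volume {p : ℝ × ℝ × ℝ | p.2.2 = f p.1 p.2.1} = 0 := by
  rw [Measure.volume_eq_prod, Measure.measure_prod_null
    (isClosed_eq (by fun_prop) (by fun_prop)).measurableSet]
  refine ae_of_all _ fun x => ?_
  change volume {y : ℝ × ℝ | y.2 = f x y.1} = 0
  rw [Measure.volume_eq_prod, Measure.measure_prod_null
    (isClosed_eq (by fun_prop) (by fun_prop) :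
      IsClosed {y : ℝ × ℝ | y.2 = f x y.1}).measurableSet]
  refine ae_of_all _ fun y => ?_
  change volume {z : ℝ | z = f x y} = 0
  exact Real.volume_singleton

section NullFrontier

variable {X : Type*} [TopologicalSpace X] [MeasureSpace X]

theorem volume_frontier_setOf_le {f g : X → ℝ} (hf : Continuous f) (hg : Continuous g)
    (h : volume {x | f x = g x} = 0) : volume (frontier {x | f x ≤ g x}) = 0 :=
  measure_mono_null (frontier_le_subset_eq hf hg) h

theorem volume_frontier_inter {s t : Set X} (hs : volume (frontier s) = 0)
    (ht : volume (frontier t) = 0) : volume (frontier (s ∩ t)) = 0 :=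
  measure_mono_null ((frontier_inter_subset s t).trans
    (Set.union_subset_union Set.inter_subset_left Set.inter_subset_right))
    (measure_union_null hs ht)

end NullFrontier

theorem mem_S3_one {x y z : ℝ} : (x, y, z) ∈ S3 1 ↔
    -6 ≤ x ∧ x ≤ 6 ∧ 4 * |x| - 9 ≤ y ∧ y ≤ 1 / 3 * x ^ 2 + 3 ∧
    -(2 / 27) * x ^ 3 + 1 / 3 * x * y + x - 2 / 27 * (x ^ 2 - 3 * y + 9) ^ ((3 : ℝ) / 2) ≤ z ∧
    z ≤ -(2 / 27) * x ^ 3 + 1 / 3 * x * y + x + 2 / 27 * (x ^ 2 - 3 * y + 9) ^ ((3 : ℝ) / 2) ∧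
    -2 * x - 2 * y - 2 ≤ z ∧ z ≤ -2 * x + 2 * y + 2 := by
  simp [S3]

theorem rpow_three_halves_sq_mul {w : ℝ} (hw : 0 < w) {y : ℝ} (hy : 0 ≤ y) :
    (w ^ 2 * y) ^ ((3 : ℝ) / 2) = w ^ 3 * y ^ ((3 : ℝ) / 2) := by
  rw [Real.mul_rpow (by positivity) hy, ← Real.rpow_natCast w 2, ← Real.rpow_mul hw.le,
    ← Real.rpow_natCast w 3]
  norm_num

theorem scaled_mem_S3_iff {w : ℝ} (hw : 0 < w) (x y z : ℝ) :
    (w * x, w ^ 2 * y, w ^ 3 * z) ∈ S3 (w ^ 2) ↔ (x, y, z) ∈ S3 1 := by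
  have hw2 : 0 < w ^ 2 := by positivity
  have hw3 : 0 < w ^ 3 := by positivity
  have hq : (w ^ 2) ^ ((3 : ℝ) / 2) = w ^ 3 := by
    simpa using rpow_three_halves_sq_mul hw zero_le_one
  have scale : ∀ {c a b a' b' : ℝ}, 0 < c → a' = c * a → b' = c * b → (a' ≤ b' ↔ a ≤ b) := by
    rintro c a b _ _ hc rfl rfl
    exact mul_le_mul_iff_right₀ hc
  rw [mem_S3_one]
  simp only [S3, Set.mem_ofPred_eq, Real.sqrt_sq hw.le, hq, abs_mul, abs_of_pos hw]
  refine and_congr (scale hw (by ring) rfl) <| and_congr (scale hw rfl (by ring)) <|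
    and_congr (scale hw2 (by ring) rfl) <|
    (and_congr_left' (scale hw2 rfl (by ring))).trans <| and_congr_right fun hy => ?_
  have hpow : ((w * x) ^ 2 - 3 * (w ^ 2 * y) + 9 * w ^ 2) ^ ((3 : ℝ) / 2) =
      w ^ 3 * (x ^ 2 - 3 * y + 9) ^ ((3 : ℝ) / 2) := by
    rw [← rpow_three_halves_sq_mul hw (by linarith)]
    congr 1
    ring
  rw [hpow]
  exact and_congr (scale hw3 (by ring) rfl) <| and_congr (scale hw3 rfl (by ring)) <|
    and_congr (scale hw3 (by ring) rfl) (scale hw3 rfl (by ring))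

theorem isBounded_S3_one : Bornology.IsBounded (S3 1) := by
  refine (Metric.isBounded_closedBall (x := 0) (r := 44)).subset ?_
  rintro ⟨x, y, z⟩ h
  obtain ⟨hx1, hx2, hy1, hy2, -, -, hz1, hz2⟩ := mem_S3_one.mp h
  have hx := abs_nonneg x
  have hxx : x ^ 2 ≤ 36 := by nlinarith
  rw [mem_closedBall_zero_iff]
  simp only [Prod.norm_mk, Real.norm_eq_abs, sup_le_iff, abs_le]
  refine ⟨⟨?_, ?_⟩, ⟨?_, ?_⟩, ?_, ?_⟩ <;> linarith

theorem continuous_S3_rpow_term (q : ℝ) : Continuous fun p : ℝ × ℝ × ℝ =>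
    (p.1 ^ 2 - 3 * p.2.1 + 9 * q) ^ ((3 : ℝ) / 2) :=
  Continuous.rpow_const (by fun_prop) fun _ => Or.inr (by norm_num)

theorem isClosed_S3 (q : ℝ) : IsClosed (S3 q) := by
  have := continuous_S3_rpow_term q
  unfold S3
  simp only [Set.ofPred_and]
  refine IsClosed.inter ?_ (IsClosed.inter ?_ (IsClosed.inter ?_ (IsClosed.inter ?_
    (IsClosed.inter ?_ (IsClosed.inter ?_ (IsClosed.inter ?_ ?_))))))
  all_goals exact isClosed_le (by fun_prop) (by fun_prop)

theorem volume_frontier_S3 (q : ℝ) : volume (frontier (S3 q)) = 0 := by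
  have hcont := continuous_S3_rpow_term q
  have hcont' : Continuous fun p : ℝ × ℝ => (p.1 ^ 2 - 3 * p.2 + 9 * q) ^ ((3 : ℝ) / 2) :=
    Continuous.rpow_const (by fun_prop) fun _ => Or.inr (by norm_num)
  have hle : ∀ {f g : ℝ × ℝ × ℝ → ℝ}, Continuous f → Continuous g →
      volume {p | f p = g p} = 0 → volume (frontier {p | f p ≤ g p}) = 0 :=
    volume_frontier_setOf_le
  have hge : ∀ {f g : ℝ × ℝ × ℝ → ℝ}, Continuous f → Continuous g →
      volume {p | g p = f p} = 0 → volume (frontier {p | f p ≤ g p}) = 0 := by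
    intro f g hf hg h
    refine volume_frontier_setOf_le hf hg ?_
    simpa only [eq_comm (a := f _)] using h
  unfold S3
  simp only [Set.ofPred_and]
  refine volume_frontier_inter (hge (by fun_prop) (by fun_prop) (volume_setOf_fst_eq _)) <|
    volume_frontier_inter (hle (by fun_prop) (by fun_prop) (volume_setOf_fst_eq _)) <|
    volume_frontier_inter (hge (by fun_prop) (by fun_prop)
      (volume_setOf_snd_fst_eq (f := fun x => 4 * √q * |x| - 9 * q) (by fun_prop))) <|
    volume_frontier_inter (hle (by fun_prop) (by fun_prop)
      (volume_setOf_snd_fst_eq (f := fun x => 1 / 3 * x ^ 2 + 3 * q) (by fun_prop))) <|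
    volume_frontier_inter (hge (by fun_prop) (by fun_prop)
      (volume_setOf_snd_snd_eq (f := fun x y => -(2 / 27) * x ^ 3 + 1 / 3 * x * y + q * x -
        2 / 27 * (x ^ 2 - 3 * y + 9 * q) ^ ((3 : ℝ) / 2))
        (by simp only [Function.uncurry_def]; fun_prop))) <|
    volume_frontier_inter (hle (by fun_prop) (by fun_prop)
      (volume_setOf_snd_snd_eq (f := fun x y => -(2 / 27) * x ^ 3 + 1 / 3 * x * y + q * x +
        2 / 27 * (x ^ 2 - 3 * y + 9 * q) ^ ((3 : ℝ) / 2))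
        (by simp only [Function.uncurry_def]; fun_prop))) <|
    volume_frontier_inter (hge (by fun_prop) (by fun_prop)
      (volume_setOf_snd_snd_eq (f := fun x y => -2 * q * x - 2 * √q * y - 2 * q ^ ((3 : ℝ) / 2))
        (by simp only [Function.uncurry_def]; fun_prop)))
    (hle (by fun_prop) (by fun_prop)
      (volume_setOf_snd_snd_eq (f := fun x y => -2 * q * x + 2 * √q * y + 2 * q ^ ((3 : ℝ) / 2))
        (by simp only [Function.uncurry_def]; fun_prop)))

theorem S3_one_mem_nhds_zero : S3 1 ∈ 𝓝 (0 : ℝ × ℝ × ℝ) := by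
  have hcont := continuous_S3_rpow_term 1
  have h9 : (9 : ℝ) ^ ((3 : ℝ) / 2) = 27 := by
    rw [show (9 : ℝ) = 3 ^ 2 * 1 by norm_num, rpow_three_halves_sq_mul three_pos zero_le_one]
    norm_num
  have hlt : ∀ {f g : ℝ × ℝ × ℝ → ℝ}, Continuous f → Continuous g → f 0 < g 0 →
      {p | f p ≤ g p} ∈ 𝓝 (0 : ℝ × ℝ × ℝ) := fun hf hg h =>
    (hf.continuousAt.eventually_lt hg.continuousAt h).mono fun _ => le_of_lt
  unfold S3
  simp only [Set.ofPred_and]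
  refine inter_mem ?_ (inter_mem ?_ (inter_mem ?_ (inter_mem ?_
    (inter_mem ?_ (inter_mem ?_ (inter_mem ?_ ?_))))))
  all_goals exact hlt (by fun_prop) (by fun_prop) (by norm_num [h9])

theorem volume_real_S3_one_pos : 0 < volume.real (S3 1) :=
  ENNReal.toReal_pos (Measure.measure_pos_of_mem_nhds _ S3_one_mem_nhds_zero).ne'
    isBounded_S3_one.measure_lt_top.ne

theorem intCast_mem_S3_iff {w : ℝ} (hw : 0 < w) (p : ℤ × ℤ × ℤ) :
    ((p.1 : ℝ), (p.2.1 : ℝ), (p.2.2 : ℝ)) ∈ S3 (w ^ 2) ↔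
      ((p.1 : ℝ) / w, (p.2.1 : ℝ) / w ^ 2, (p.2.2 : ℝ) / w ^ 3) ∈ S3 1 := by
  rw [← scaled_mem_S3_iff hw, mul_div_cancel₀ _ hw.ne', mul_div_cancel₀ _ (pow_ne_zero 2 hw.ne'),
    mul_div_cancel₀ _ (pow_ne_zero 3 hw.ne')]

theorem latticeCount_sq {w : ℝ} (hw : 0 < w) :
    latticeCount (w ^ 2) = {k | scaledPoint (w, w ^ 2, w ^ 3) 0 k ∈ S3 1}.ncard := by
  simp only [latticeCount, intCast_mem_S3_iff hw, scaledPoint, Prod.fst_zero, Prod.snd_zero,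
    add_zero]

theorem latticeCountMod2_sq {w : ℝ} (hw : 0 < w) (m : ℤ × ℤ × ℤ) :
    latticeCountMod2 (w ^ 2) (m.1, m.2.1, m.2.2) =
      {k | scaledPoint (w / 2, w ^ 2 / 2, w ^ 3 / 2) (m.1 / 2, m.2.1 / 2, m.2.2 / 2) k
        ∈ S3 1}.ncard := by
  set φ : ℤ × ℤ × ℤ → ℤ × ℤ × ℤ := fun k =>
    (m.1 + 2 * k.1, m.2.1 + 2 * k.2.1, m.2.2 + 2 * k.2.2) with hφ
  have hinj : Function.Injective φ := by
    rintro ⟨a, b, c⟩ ⟨a', b', c'⟩ h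
    simpa [hφ] using h
  have hpt : ∀ k : ℤ × ℤ × ℤ,
      scaledPoint (w / 2, w ^ 2 / 2, w ^ 3 / 2) (m.1 / 2, m.2.1 / 2, m.2.2 / 2) k =
        (((φ k).1 : ℝ) / w, ((φ k).2.1 : ℝ) / w ^ 2, ((φ k).2.2 : ℝ) / w ^ 3) := by
    intro k
    simp only [scaledPoint, hφ, Prod.mk.injEq, Int.cast_add, Int.cast_mul, Int.cast_ofNat]
    refine ⟨?_, ?_, ?_⟩ <;> field_simp <;> ring
  have hmod : ∀ a b : ℤ, (a : ZMod 2) = b ↔ ∃ k, b + 2 * k = a := by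
    intro a b
    rw [eq_comm, ZMod.intCast_eq_intCast_iff_dvd_sub]
    exact exists_congr fun k => by push_cast; constructor <;> intro h <;> linarith
  rw [← Set.ncard_image_of_injective _ hinj, latticeCountMod2]
  congr 1
  ext p
  simp only [Set.mem_ofPred_eq, Set.mem_image, hpt, ← intCast_mem_S3_iff hw, hmod]
  constructor
  · rintro ⟨h, ⟨a, ha⟩, ⟨b, hb⟩, c, hc⟩
    have hp : φ (a, b, c) = p := by simp [hφ, ha, hb, hc]
    exact ⟨(a, b, c), by rwa [hp], hp⟩
  · rintro ⟨k, h, rfl⟩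
    exact ⟨h, ⟨k.1, rfl⟩, ⟨k.2.1, rfl⟩, k.2.2, rfl⟩

theorem parity_equidistribution_genus3 (r : ZMod 2 × ZMod 2 × ZMod 2) :
    Tendsto (fun q : ℝ => (latticeCountMod2 q r : ℝ) / (latticeCount q : ℝ))
      atTop (nhds (1 / 8)) := by
  obtain ⟨r₁, r₂, r₃⟩ := r
  obtain ⟨m₁, rfl⟩ := ZMod.intCast_surjective r₁
  obtain ⟨m₂, rfl⟩ := ZMod.intCast_surjective r₂
  obtain ⟨m₃, rfl⟩ := ZMod.intCast_surjective r₃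
  have h1 := Real.tendsto_sqrt_atTop
  have h2 := (tendsto_pow_atTop two_ne_zero).comp h1
  have h3 := (tendsto_pow_atTop three_ne_zero).comp h1
  have hcount := fun {a b c : ℝ → ℝ} => tendsto_ncard_scaledPoint_mem_div (a := a) (b := b)
    (c := c) (l := atTop) isBounded_S3_one (isClosed_S3 1).measurableSet (volume_frontier_S3 1)
  have hall := hcount h1 h2 h3 0
  have hmod := hcount (h1.atTop_div_const two_pos) (h2.atTop_div_const two_pos)
    (h3.atTop_div_const two_pos) (m₁ / 2, m₂ / 2, m₃ / 2)
  have hV := volume_real_S3_one_pos.ne'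
  have hlim := (hmod.div hall hV).div_const 8
  rw [div_self hV] at hlim
  refine hlim.congr' ?_
  filter_upwards [eventually_gt_atTop 0] with q hq
  have hw : 0 < √q := Real.sqrt_pos.mpr hq
  have hN := latticeCount_sq hw
  have hM := latticeCountMod2_sq hw (m₁, m₂, m₃)
  rw [Real.sq_sqrt hq.le] at hN hM
  simp only [Pi.div_apply, Function.comp_apply, hN, hM, Real.sq_sqrt hq.le]
  field_simp
  ring
end

section
/- For every real number q > 0, the Lebesgue measure of S₃(q) equals q³ times the Lebesgue measure of S₃(1); moreover, the Lebesgue measure of S₃(1) is positive and finite. In particular, the volume of S₃(q) is Θ(q³) as q → ∞. -/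
open MeasureTheory

/-- The weighted dilation `(s, t, u) ↦ (r s, r² t, r³ u)` of `ℝ³`. -/
noncomputable def weightedDilation (r : ℝ) : (ℝ × ℝ × ℝ) →ₗ[ℝ] (ℝ × ℝ × ℝ) :=
  (r • LinearMap.id).prodMap ((r ^ 2 • LinearMap.id).prodMap (r ^ 3 • LinearMap.id))

theorem weightedDilation_apply (r : ℝ) (p : ℝ × ℝ × ℝ) :
    weightedDilation r p = (r * p.1, r ^ 2 * p.2.1, r ^ 3 * p.2.2) := rfl

theorem det_weightedDilation (r : ℝ) : LinearMap.det (weightedDilation r) = (r ^ 2) ^ 3 := by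
  simp only [weightedDilation, LinearMap.det_prodMap, LinearMap.det_smul, LinearMap.det_id,
    Module.finrank_self]
  ring

theorem weightedDilation_mem_S3_iff {r : ℝ} (hr : 0 < r) (p : ℝ × ℝ × ℝ) :
    weightedDilation r p ∈ S3 (r ^ 2) ↔ p ∈ S3 1 := by
  obtain ⟨s, t, u⟩ := p
  have hr2 : (r ^ 2) ^ ((3 : ℝ) / 2) = r ^ 3 := by
    rw [← Real.rpow_natCast r 2, ← Real.rpow_mul hr.le, ← Real.rpow_natCast r 3]
    norm_num
  simp only [weightedDilation_apply, S3, Set.mem_ofPred_eq, Real.sqrt_sq hr.le, hr2,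
    Real.sqrt_one, Real.one_rpow, abs_mul, abs_of_pos hr]
  have ht_iff : r ^ 2 * t ≤ 1 / 3 * (r * s) ^ 2 + 3 * r ^ 2 ↔ t ≤ 1 / 3 * s ^ 2 + 3 * 1 := by
    rw [← mul_le_mul_iff_right₀ (pow_pos hr 2) (b := t)]
    ring_nf
  rw [ht_iff]
  refine and_congr ?_ (and_congr ?_ (and_congr ?_ (and_congr_right fun ht => ?_)))
  · rw [← mul_le_mul_iff_right₀ hr (b := -6 * 1)]
    ring_nf
  · rw [← mul_le_mul_iff_right₀ hr (b := s)]
    ring_nf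
  · rw [← mul_le_mul_iff_right₀ (pow_pos hr 2) (b := 4 * 1 * |s| - 9 * 1)]
    ring_nf
  have hX : 0 ≤ s ^ 2 - 3 * t + 9 * 1 := by linarith
  have hpow : ((r * s) ^ 2 - 3 * (r ^ 2 * t) + 9 * r ^ 2) ^ ((3 : ℝ) / 2) =
      r ^ 3 * (s ^ 2 - 3 * t + 9 * 1) ^ ((3 : ℝ) / 2) := by
    rw [← hr2, ← Real.mul_rpow (by positivity) hX]
    ring_nf
  rw [hpow]
  generalize (s ^ 2 - 3 * t + 9 * 1) ^ ((3 : ℝ) / 2) = y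
  have hr3 : 0 < r ^ 3 := by positivity
  refine and_congr ?_ (and_congr ?_ (and_congr ?_ ?_)) <;>
    refine Iff.trans ?_ (mul_le_mul_iff_right₀ hr3) <;> ring_nf

theorem volume_S3_sq {r : ℝ} (hr : 0 < r) :
    volume (S3 1) = ENNReal.ofReal ((r ^ 2) ^ 3)⁻¹ * volume (S3 (r ^ 2)) := by
  have hpre : weightedDilation r ⁻¹' S3 (r ^ 2) = S3 1 :=
    Set.ext (weightedDilation_mem_S3_iff hr)
  have hpos : 0 < (r ^ 2) ^ 3 := by positivity
  have hdet : LinearMap.det (weightedDilation r) ≠ 0 := by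
    rw [det_weightedDilation]
    exact hpos.ne'
  have : (volume : Measure (ℝ × ℝ)).IsAddHaarMeasure :=
    Measure.prod.instIsAddHaarMeasure volume volume
  have : (volume : Measure (ℝ × ℝ × ℝ)).IsAddHaarMeasure :=
    Measure.prod.instIsAddHaarMeasure volume volume
  rw [← hpre, Measure.addHaar_preimage_linearMap _ hdet, det_weightedDilation,
    abs_of_pos (inv_pos.2 hpos)]

theorem volume_S3_one_pos : 0 < volume (S3 1) := by
  let U : Set (ℝ × ℝ × ℝ) := {p |
    -6 < p.1 ∧ p.1 < 6 ∧ 4 * |p.1| - 9 < p.2.1 ∧ p.2.1 < (1 / 3) * p.1 ^ 2 + 3 ∧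
    -(2 / 27) * p.1 ^ 3 + (1 / 3) * p.1 * p.2.1 + p.1 -
        (2 / 27) * (p.1 ^ 2 - 3 * p.2.1 + 9) ^ ((3 : ℝ) / 2) < p.2.2 ∧
    p.2.2 < -(2 / 27) * p.1 ^ 3 + (1 / 3) * p.1 * p.2.1 + p.1 +
        (2 / 27) * (p.1 ^ 2 - 3 * p.2.1 + 9) ^ ((3 : ℝ) / 2) ∧
    -2 * p.1 - 2 * p.2.1 - 2 < p.2.2 ∧ p.2.2 < -2 * p.1 + 2 * p.2.1 + 2}
  have hrpow : Continuous fun p : ℝ × ℝ × ℝ =>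
      (p.1 ^ 2 - 3 * p.2.1 + 9) ^ ((3 : ℝ) / 2) :=
    Continuous.rpow_const (by fun_prop) fun _ => Or.inr (by norm_num)
  have hU : IsOpen U := by
    refine IsOpen.and ?_ <| IsOpen.and ?_ <| IsOpen.and ?_ <| IsOpen.and ?_ <|
      IsOpen.and ?_ <| IsOpen.and ?_ <| IsOpen.and ?_ ?_ <;>
    exact isOpen_lt (by fun_prop) (by fun_prop)
  have h0 : (0 : ℝ × ℝ × ℝ) ∈ U := by
    have : (0 : ℝ) < 9 ^ ((3 : ℝ) / 2) := by positivity
    simp [U, this]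
  have hsub : U ⊆ S3 1 := by
    rintro p ⟨h1, h2, h3, h4, h5, h6, h7, h8⟩
    simp only [S3, Set.mem_ofPred_eq, Real.sqrt_one, Real.one_rpow, mul_one, one_mul]
    exact ⟨h1.le, h2.le, h3.le, h4.le, h5.le, h6.le, h7.le, h8.le⟩
  exact (hU.measure_pos volume ⟨0, h0⟩).trans_le (measure_mono hsub)

theorem volume_S3_one_lt_top : volume (S3 1) < ⊤ := by
  have hsub : S3 1 ⊆ Set.Icc (-6, -9, -44) (6, 15, 44) := by
    rintro ⟨s, t, u⟩ ⟨h1, h2, h3, h4, -, -, h7, h8⟩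
    simp only [Real.sqrt_one, Real.one_rpow, mul_one] at h1 h2 h3 h4 h7 h8
    have hs := abs_nonneg s
    have ht : t ≤ 15 := by nlinarith
    simp only [Set.mem_Icc, Prod.mk_le_mk]
    refine ⟨⟨?_, ?_, ?_⟩, ?_, ?_, ?_⟩ <;> linarith
  exact (measure_mono hsub).trans_lt isCompact_Icc.measure_lt_top

theorem volume_S3_scaling (q : ℝ) (hq : 0 < q) :
    volume (S3 q) = ENNReal.ofReal (q ^ 3) * volume (S3 1) ∧
      0 < volume (S3 1) ∧ volume (S3 1) < ⊤ := by
  refine ⟨?_, volume_S3_one_pos, volume_S3_one_lt_top⟩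
  have h := volume_S3_sq (Real.sqrt_pos.2 hq)
  rw [Real.sq_sqrt hq.le] at h
  rw [h, ← mul_assoc, ← ENNReal.ofReal_mul (by positivity), mul_inv_cancel₀ (by positivity),
    ENNReal.ofReal_one, one_mul]
end

section
/- There exist a constant C > 0 and a real number Q₀ ≥ 1 such that for all real q ≥ Q₀, the Lebesgue measure of the set of points of ℝ³ at distance at most 4 from the topological boundary (frontier) of S₃(q) is at most C·q^{5/2}. -/
open MeasureTheory

/-- The region `S₃(q)` of (real) coefficient triples of genus-3 Weil polynomials, viewed
inside Euclidean 3-space. -/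
def S3E (q : ℝ) : Set (EuclideanSpace ℝ (Fin 3)) :=
  {x : EuclideanSpace ℝ (Fin 3) |
    -6 * Real.sqrt q ≤ x 0 ∧ x 0 ≤ 6 * Real.sqrt q ∧
    4 * Real.sqrt q * |x 0| - 9 * q ≤ x 1 ∧ x 1 ≤ (1 / 3) * (x 0) ^ 2 + 3 * q ∧
    -(2 / 27) * (x 0) ^ 3 + (1 / 3) * (x 0) * (x 1) + q * (x 0) -
        (2 / 27) * ((x 0) ^ 2 - 3 * (x 1) + 9 * q) ^ ((3 : ℝ) / 2) ≤ x 2 ∧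
    x 2 ≤ -(2 / 27) * (x 0) ^ 3 + (1 / 3) * (x 0) * (x 1) + q * (x 0) +
        (2 / 27) * ((x 0) ^ 2 - 3 * (x 1) + 9 * q) ^ ((3 : ℝ) / 2) ∧
    -2 * q * (x 0) - 2 * Real.sqrt q * (x 1) - 2 * q ^ ((3 : ℝ) / 2) ≤ x 2 ∧
    x 2 ≤ -2 * q * (x 0) + 2 * Real.sqrt q * (x 1) + 2 * q ^ ((3 : ℝ) / 2)}

theorem volume_prod_graph_neighborhood {α : Type*} [MeasurableSpace α] (μ : Measure α) [SFinite μ]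
    {A : Set α} (hA : MeasurableSet A) {f : α → ℝ} (hf : Measurable f) (r : ℝ) :
    ((volume : Measure ℝ).prod μ) {p | p.2 ∈ A ∧ |p.1 - f p.2| ≤ r} =
      ENNReal.ofReal (2 * r) * μ A := by
  have hm : MeasurableSet {p : ℝ × α | p.2 ∈ A ∧ |p.1 - f p.2| ≤ r} :=
    (measurable_snd hA).inter
      (measurableSet_le (measurable_fst.sub (hf.comp measurable_snd)).abs measurable_const)
  rw [Measure.prod_apply_symm hm, ← lintegral_indicator_const hA]
  refine lintegral_congr fun a => ?_
  by_cases ha : a ∈ A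
  · have : (fun x : ℝ => (x, a)) ⁻¹' {p : ℝ × α | p.2 ∈ A ∧ |p.1 - f p.2| ≤ r} =
        Metric.closedBall (f a) r := by
      ext x; simp [ha, Real.dist_eq]
    rw [this, Real.volume_closedBall, Set.indicator_of_mem ha]
  · have : (fun x : ℝ => (x, a)) ⁻¹' {p : ℝ × α | p.2 ∈ A ∧ |p.1 - f p.2| ≤ r} = ∅ := by
      ext x; simp [ha]
    rw [this, measure_empty, Set.indicator_of_notMem ha]

/-- The points of 3-space near a point in the first coordinate, near the graph of `g` in the
second and near the graph of `f` in the third. -/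
def graphTube (a : ℝ) (g : ℝ → ℝ) (f : ℝ → ℝ → ℝ) (r₀ r₁ r₂ : ℝ) :
    Set (EuclideanSpace ℝ (Fin 3)) :=
  {x | |x 0 - a| ≤ r₀ ∧ |x 1 - g (x 0)| ≤ r₁ ∧ |x 2 - f (x 0) (x 1)| ≤ r₂}

theorem volume_graphTube (a : ℝ) {g : ℝ → ℝ} {f : ℝ → ℝ → ℝ} (hg : Measurable g)
    (hf : Measurable fun p : ℝ × ℝ => f p.1 p.2) {r₀ r₁ r₂ : ℝ}
    (h₁ : 0 ≤ r₁) (h₂ : 0 ≤ r₂) :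
    volume (graphTube a g f r₀ r₁ r₂) = ENNReal.ofReal (8 * r₀ * r₁ * r₂) := by
  have e₃ := (volume_preserving_piFinSuccAbove (fun _ : Fin 3 => ℝ) 2).comp
    (EuclideanSpace.volume_preserving_symm_measurableEquiv_toLp (Fin 3))
  have e₂ := (volume_preserving_piFinTwo (fun _ : Fin 2 => ℝ))
  have m1 : MeasurableSet {p : ℝ × ℝ | p.2 ∈ Metric.closedBall a r₀ ∧ |p.1 - g p.2| ≤ r₁} :=
    (measurable_snd measurableSet_closedBall).inter
      (measurableSet_le (measurable_fst.sub (hg.comp measurable_snd)).abs measurable_const)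
  have c (i : Fin 2) : Measurable fun v : Fin 2 → ℝ => v i := measurable_pi_apply i
  have m2 : MeasurableSet {v : Fin 2 → ℝ | |v 0 - a| ≤ r₀ ∧ |v 1 - g (v 0)| ≤ r₁} :=
    (measurableSet_le ((c 0).sub_const a).abs measurable_const).inter
      (measurableSet_le ((c 1).sub (hg.comp (c 0))).abs measurable_const)
  have hF : Measurable fun v : Fin 2 → ℝ => f (v 0) (v 1) :=
    hf.comp ((c 0).prodMk (c 1))
  have v1 := volume_prod_graph_neighborhood volume (measurableSet_closedBall (x := a) (ε := r₀)) hg r₁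
  have v2 := volume_prod_graph_neighborhood volume m2 hF r₂
  have m3 : MeasurableSet {p : ℝ × (Fin 2 → ℝ) |
      p.2 ∈ {v : Fin 2 → ℝ | |v 0 - a| ≤ r₀ ∧ |v 1 - g (v 0)| ≤ r₁} ∧
        |p.1 - f (p.2 0) (p.2 1)| ≤ r₂} :=
    (measurable_snd m2).inter (measurableSet_le
      (measurable_fst.sub (hF.comp measurable_snd)).abs measurable_const)
  have w2 : volume {v : Fin 2 → ℝ | |v 0 - a| ≤ r₀ ∧ |v 1 - g (v 0)| ≤ r₁} =
      ENNReal.ofReal (2 * r₁) * ENNReal.ofReal (2 * r₀) := by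
    rw [← Real.volume_closedBall a r₀, ← v1,
      ← (Measure.measurePreserving_swap.comp e₂).measure_preimage m1.nullMeasurableSet]
    rfl
  have w3 := e₃.measure_preimage m3.nullMeasurableSet
  rw [show (volume : Measure (ℝ × (Fin 2 → ℝ))) = volume.prod volume from rfl] at w3
  have key : volume (graphTube a g f r₀ r₁ r₂) = ENNReal.ofReal (2 * r₂) *
      (ENNReal.ofReal (2 * r₁) * ENNReal.ofReal (2 * r₀)) := by
    rw [← w2, ← v2, ← w3]
    congr 1
    ext x
    constructor
    · rintro ⟨a, b, c⟩; exact ⟨⟨a, b⟩, c⟩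
    · rintro ⟨⟨a, b⟩, c⟩; exact ⟨a, b, c⟩
  rw [key, ← ENNReal.ofReal_mul (by positivity), ← ENNReal.ofReal_mul (by positivity)]
  congr 1
  ring

/-- The third coordinate on the sheet of the discriminant surface with sign `ε`, for `q = k ^ 2`. -/
noncomputable def discSheet (ε k s t : ℝ) : ℝ :=
  -(2 / 27) * s ^ 3 + (1 / 3) * s * t + k ^ 2 * s +
    ε * ((2 / 27) * Real.sqrt (s ^ 2 - 3 * t + 9 * k ^ 2) ^ 3)

/-- The third coordinate on the bounding plane with sign `ε`, for `q = k ^ 2`. -/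
def planeSheet (ε k s t : ℝ) : ℝ :=
  -2 * k ^ 2 * s + ε * (2 * k * t + 2 * k ^ 3)

theorem sq_rpow_half_eq {k : ℝ} (hk : 0 ≤ k) (n : ℕ) : (k ^ 2) ^ ((n : ℝ) / 2) = k ^ n := by
  rw [← Real.rpow_natCast k 2, ← Real.rpow_mul hk, ← Real.rpow_natCast k n]
  congr 1
  push_cast
  ring

theorem rpow_three_halves {a : ℝ} (ha : 0 ≤ a) : a ^ ((3 : ℝ) / 2) = Real.sqrt a ^ 3 := by
  have := sq_rpow_half_eq (Real.sqrt_nonneg a) 3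
  rwa [Real.sq_sqrt ha] at this

theorem mem_S3E_sq {k : ℝ} (hk : 0 ≤ k) (x : EuclideanSpace ℝ (Fin 3)) :
    x ∈ S3E (k ^ 2) ↔ -6 * k ≤ x 0 ∧ x 0 ≤ 6 * k ∧
      4 * k * |x 0| - 9 * k ^ 2 ≤ x 1 ∧ x 1 ≤ (1 / 3) * (x 0) ^ 2 + 3 * k ^ 2 ∧
      discSheet (-1) k (x 0) (x 1) ≤ x 2 ∧ x 2 ≤ discSheet 1 k (x 0) (x 1) ∧
      planeSheet (-1) k (x 0) (x 1) ≤ x 2 ∧ x 2 ≤ planeSheet 1 k (x 0) (x 1) := by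
  have hk3 : (k ^ 2) ^ ((3 : ℝ) / 2) = k ^ 3 := mod_cast sq_rpow_half_eq hk 3
  simp only [S3E, Set.mem_ofPred_eq, Real.sqrt_sq hk, hk3, discSheet, planeSheet]
  refine and_congr_right fun _ => and_congr_right fun _ => and_congr_right fun _ =>
    and_congr_right fun ht => ?_
  rw [rpow_three_halves (by linarith : 0 ≤ x 0 ^ 2 - 3 * x 1 + 9 * k ^ 2)]
  ring_nf

theorem continuous_discSheet (ε k : ℝ) : Continuous fun p : ℝ × ℝ => discSheet ε k p.1 p.2 := by
  unfold discSheet; fun_prop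

theorem continuous_planeSheet (ε k : ℝ) : Continuous fun p : ℝ × ℝ => planeSheet ε k p.1 p.2 := by
  unfold planeSheet; fun_prop

theorem frontier_S3E_sq {k : ℝ} (hk : 0 ≤ k) {y : EuclideanSpace ℝ (Fin 3)}
    (hy : y ∈ frontier (S3E (k ^ 2))) :
    y ∈ S3E (k ^ 2) ∧ (-6 * k = y 0 ∨ y 0 = 6 * k ∨
      4 * k * |y 0| - 9 * k ^ 2 = y 1 ∨ y 1 = (1 / 3) * (y 0) ^ 2 + 3 * k ^ 2 ∨
      discSheet (-1) k (y 0) (y 1) = y 2 ∨ y 2 = discSheet 1 k (y 0) (y 1) ∨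
      planeSheet (-1) k (y 0) (y 1) = y 2 ∨ y 2 = planeSheet 1 k (y 0) (y 1)) := by
  have c (i : Fin 3) : Continuous fun x : EuclideanSpace ℝ (Fin 3) => x i := by fun_prop
  have cd (ε : ℝ) : Continuous fun x : EuclideanSpace ℝ (Fin 3) => discSheet ε k (x 0) (x 1) :=
    (continuous_discSheet ε k).comp ((c 0).prodMk (c 1))
  have cp (ε : ℝ) : Continuous fun x : EuclideanSpace ℝ (Fin 3) => planeSheet ε k (x 0) (x 1) :=
    (continuous_planeSheet ε k).comp ((c 0).prodMk (c 1))
  have cm : Continuous fun x : EuclideanSpace ℝ (Fin 3) => 4 * k * |x 0| - 9 * k ^ 2 := by fun_prop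
  have cM : Continuous fun x : EuclideanSpace ℝ (Fin 3) => (1 / 3) * (x 0) ^ 2 + 3 * k ^ 2 := by
    fun_prop
  have c₁ : Continuous fun _ : EuclideanSpace ℝ (Fin 3) => -6 * k := continuous_const
  have c₂ : Continuous fun _ : EuclideanSpace ℝ (Fin 3) => 6 * k := continuous_const
  have hS : IsClosed (S3E (k ^ 2)) := by
    rw [Set.ext fun x => mem_S3E_sq hk x]
    exact (isClosed_le c₁ (c 0)).inter <| (isClosed_le (c 0) c₂).inter <|
      (isClosed_le cm (c 1)).inter <| (isClosed_le (c 1) cM).inter <|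
      (isClosed_le (cd _) (c 2)).inter <| (isClosed_le (c 2) (cd _)).inter <|
      (isClosed_le (cp _) (c 2)).inter (isClosed_le (c 2) (cp _))
  have hyS := hS.frontier_subset hy
  refine ⟨hyS, ?_⟩
  by_contra! hne
  refine hy.2 (mem_interior_iff_mem_nhds.2 ?_)
  obtain ⟨n1, n2, n3, n4, n5, n6, n7, n8⟩ := hne
  obtain ⟨h1, h2, h3, h4, h5, h6, h7, h8⟩ := (mem_S3E_sq hk y).1 hyS
  filter_upwards [c₁.continuousAt.eventually_lt (c 0).continuousAt (lt_of_le_of_ne h1 n1),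
    (c 0).continuousAt.eventually_lt c₂.continuousAt (lt_of_le_of_ne h2 n2),
    cm.continuousAt.eventually_lt (c 1).continuousAt (lt_of_le_of_ne h3 n3),
    (c 1).continuousAt.eventually_lt cM.continuousAt (lt_of_le_of_ne h4 n4),
    (cd _).continuousAt.eventually_lt (c 2).continuousAt (lt_of_le_of_ne h5 n5),
    (c 2).continuousAt.eventually_lt (cd _).continuousAt (lt_of_le_of_ne h6 n6),
    (cp _).continuousAt.eventually_lt (c 2).continuousAt (lt_of_le_of_ne h7 n7),
    (c 2).continuousAt.eventually_lt (cp _).continuousAt (lt_of_le_of_ne h8 n8)]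
    with x x1 x2 x3 x4 x5 x6 x7 x8
  exact (mem_S3E_sq hk x).2 ⟨x1.le, x2.le, x3.le, x4.le, x5.le, x6.le, x7.le, x8.le⟩

theorem abs_sqrt_cube_sub_le {a b M : ℝ} (ha : Real.sqrt a ≤ M) (hb : Real.sqrt b ≤ M) :
    |Real.sqrt a ^ 3 - Real.sqrt b ^ 3| ≤ |a - b| * (2 * M) := by
  have ha0 := Real.sqrt_nonneg a
  have hb0 := Real.sqrt_nonneg b
  have hsq : |Real.sqrt a ^ 2 - Real.sqrt b ^ 2| ≤ |a - b| := by
    rw [Real.sq_sqrt', Real.sq_sqrt']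
    exact abs_max_sub_max_le_abs a b 0
  have hfac : Real.sqrt a ^ 3 - Real.sqrt b ^ 3 = (Real.sqrt a - Real.sqrt b) *
      (Real.sqrt a ^ 2 + Real.sqrt a * Real.sqrt b + Real.sqrt b ^ 2) := by ring
  calc |Real.sqrt a ^ 3 - Real.sqrt b ^ 3|
      ≤ |Real.sqrt a - Real.sqrt b| * (Real.sqrt a + Real.sqrt b) ^ 2 := by
        rw [hfac, abs_mul, abs_of_nonneg (by positivity :
          0 ≤ Real.sqrt a ^ 2 + Real.sqrt a * Real.sqrt b + Real.sqrt b ^ 2)]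
        gcongr
        nlinarith [mul_nonneg ha0 hb0]
    _ = |Real.sqrt a ^ 2 - Real.sqrt b ^ 2| * (Real.sqrt a + Real.sqrt b) := by
        rw [sq_sub_sq, abs_mul, abs_of_nonneg (add_nonneg ha0 hb0)]
        ring
    _ ≤ |a - b| * (2 * M) := by gcongr; linarith

section Increments

variable {k s s' t t' : ℝ} (hk : 1 ≤ k) (hs : |s| ≤ 11 * k) (hs' : |s'| ≤ 11 * k)
  (ht : |t| ≤ 20 * k ^ 2) (ht' : |t'| ≤ 20 * k ^ 2) (hds : |s - s'| ≤ 5) (hdt : |t - t'| ≤ 5)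

include hs hs' hds

theorem abs_sq_sub_sq_le : |s ^ 2 - s' ^ 2| ≤ 110 * k := by
  rw [sq_sub_sq, abs_mul]
  have : |s + s'| ≤ 22 * k := (abs_add_le _ _).trans (by linarith)
  nlinarith [mul_le_mul this hds (abs_nonneg _) ((abs_nonneg _).trans this)]

include hk ht ht' hdt

theorem abs_discSheet_sub_le {ε : ℝ} (hε : |ε| = 1) :
    |discSheet ε k s t - discSheet ε k s' t'| ≤ 1000 * k ^ 2 := by
  have hk2 : k ≤ k ^ 2 := by nlinarith
  have sqb {a : ℝ} (h : |a| ≤ 11 * k) : a ^ 2 ≤ 121 * k ^ 2 := by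
    nlinarith [sq_abs a, mul_le_mul h h (abs_nonneg _) ((abs_nonneg _).trans h)]
  have cube : |s ^ 3 - s' ^ 3| ≤ 5 * (363 * k ^ 2) := by
    rw [show s ^ 3 - s' ^ 3 = (s - s') * (s ^ 2 + s * s' + s' ^ 2) by ring, abs_mul]
    have : |s ^ 2 + s * s' + s' ^ 2| ≤ 363 * k ^ 2 := by
      have := sqb hs
      have := sqb hs'
      rw [abs_le]
      constructor <;> nlinarith [sq_nonneg (s + s'), sq_nonneg (s - s')]
    gcongr
  have mixed : |s * t - s' * t'| ≤ 155 * k ^ 2 := by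
    rw [show s * t - s' * t' = s * (t - t') + (s - s') * t' by ring]
    refine (abs_add_le _ _).trans ?_
    rw [abs_mul, abs_mul]
    have h1 := mul_le_mul hs hdt (abs_nonneg _) ((abs_nonneg _).trans hs)
    have h2 := mul_le_mul hds ht' (abs_nonneg _) (by norm_num)
    linarith
  have lin : |k ^ 2 * s - k ^ 2 * s'| ≤ 5 * k ^ 2 := by
    rw [← mul_sub, abs_mul, abs_of_nonneg (sq_nonneg k)]
    nlinarith [sq_nonneg k]
  have root {a b : ℝ} (ha : |a| ≤ 11 * k) (hb : |b| ≤ 20 * k ^ 2) :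
      Real.sqrt (a ^ 2 - 3 * b + 9 * k ^ 2) ≤ 14 * k := by
    rw [Real.sqrt_le_left (by linarith)]
    nlinarith [sqb ha, (abs_le.1 hb).1]
  have hdisc : |(s ^ 2 - 3 * t + 9 * k ^ 2) - (s' ^ 2 - 3 * t' + 9 * k ^ 2)| ≤ 125 * k := by
    have h1 := abs_le.1 (abs_sq_sub_sq_le hs hs' hds)
    have h2 := abs_le.1 hdt
    rw [abs_le]
    constructor <;> linarith [h1.1, h1.2, h2.1, h2.2]
  have rad : |Real.sqrt (s ^ 2 - 3 * t + 9 * k ^ 2) ^ 3 -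
      Real.sqrt (s' ^ 2 - 3 * t' + 9 * k ^ 2) ^ 3| ≤ 3500 * k ^ 2 := by
    refine (abs_sqrt_cube_sub_le (root hs ht) (root hs' ht')).trans ?_
    nlinarith [mul_le_mul_of_nonneg_right hdisc (by linarith : 0 ≤ 2 * (14 * k))]
  have rad' : |ε * (Real.sqrt (s ^ 2 - 3 * t + 9 * k ^ 2) ^ 3 -
      Real.sqrt (s' ^ 2 - 3 * t' + 9 * k ^ 2) ^ 3)| ≤ 3500 * k ^ 2 := by
    rwa [abs_mul, hε, one_mul]
  unfold discSheet
  rw [abs_le] at cube mixed lin rad' ⊢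
  constructor <;> linarith [cube.1, cube.2, mixed.1, mixed.2, lin.1, lin.2, rad'.1, rad'.2]

omit hs hs' ht ht' in
theorem abs_planeSheet_sub_le {ε : ℝ} (hε : |ε| = 1) :
    |planeSheet ε k s t - planeSheet ε k s' t'| ≤ 20 * k ^ 2 := by
  have hk2 : k ≤ k ^ 2 := by nlinarith
  have h1 : |2 * k ^ 2 * (s - s')| ≤ 10 * k ^ 2 := by
    rw [abs_mul, abs_of_nonneg (by positivity : 0 ≤ 2 * k ^ 2)]
    nlinarith [sq_nonneg k]
  have h2 : |ε * (2 * k * (t - t'))| ≤ 10 * k := by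
    rw [abs_mul, hε, one_mul, abs_mul, abs_of_nonneg (by linarith : 0 ≤ 2 * k)]
    nlinarith
  unfold planeSheet
  rw [abs_le] at h1 h2 ⊢
  constructor <;> linarith [h1.1, h1.2, h2.1, h2.2]

end Increments

/-- The tubes covering the neighborhood of the frontier of `S3E (k ^ 2)` are those around the
parts of the surfaces on which one of the defining inequalities is an equality. -/
theorem cthickening_frontier_S3E_sq_subset {k : ℝ} (hk : 1 ≤ k) :
    Metric.cthickening 4 (frontier (S3E (k ^ 2))) ⊆
      (graphTube (-6 * k) (fun _ => 0) (fun _ _ => 0) 5 (20 * k ^ 2) (49 * k ^ 3) ∪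
        graphTube (6 * k) (fun _ => 0) (fun _ _ => 0) 5 (20 * k ^ 2) (49 * k ^ 3)) ∪
      (graphTube 0 (fun s => 4 * k * |s| - 9 * k ^ 2) (fun _ _ => 0)
          (11 * k) (45 * k) (49 * k ^ 3) ∪
        graphTube 0 (fun s => (1 / 3) * s ^ 2 + 3 * k ^ 2) (fun _ _ => 0)
          (11 * k) (45 * k) (49 * k ^ 3)) ∪
      (graphTube 0 (fun _ => 0) (discSheet (-1) k) (11 * k) (20 * k ^ 2) (1005 * k ^ 2) ∪
        graphTube 0 (fun _ => 0) (discSheet 1 k) (11 * k) (20 * k ^ 2) (1005 * k ^ 2)) ∪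
      (graphTube 0 (fun _ => 0) (planeSheet (-1) k) (11 * k) (20 * k ^ 2) (1005 * k ^ 2) ∪
        graphTube 0 (fun _ => 0) (planeSheet 1 k) (11 * k) (20 * k ^ 2) (1005 * k ^ 2)) := by
  intro x hx
  obtain ⟨y, hy, hxy⟩ := Metric.mem_thickening_iff.1
    (Metric.cthickening_subset_thickening' (by norm_num : (0 : ℝ) < 5) (by norm_num) _ hx)
  obtain ⟨hyS, hyeq⟩ := frontier_S3E_sq (by linarith) hy
  have hd (i : Fin 3) : |x i - y i| ≤ 5 := by
    have := PiLp.norm_apply_le (x - y) i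
    rw [← dist_eq_norm] at this
    simpa [Real.norm_eq_abs] using this.trans hxy.le
  obtain ⟨h1, h2, h3, h4, -, -, h7, h8⟩ := (mem_S3E_sq (by linarith) y).1 hyS
  have hk2 : k ≤ k ^ 2 := by nlinarith
  have hk3 : k ^ 2 ≤ k ^ 3 := by nlinarith [sq_nonneg k]
  have hy0 : |y 0| ≤ 6 * k := abs_le.2 ⟨by linarith, h2⟩
  have hy0sq : y 0 ^ 2 ≤ 36 * k ^ 2 := by nlinarith
  have hy1 : |y 1| ≤ 15 * k ^ 2 := by
    refine abs_le.2 ⟨?_, by linarith⟩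
    have : 0 ≤ 4 * k * |y 0| := by positivity
    linarith [sq_nonneg k]
  have hy2 : |y 2| ≤ 44 * k ^ 3 := by
    have a1 : |2 * k ^ 2 * y 0| ≤ 12 * k ^ 3 := by
      rw [abs_mul, abs_of_nonneg (by positivity : 0 ≤ 2 * k ^ 2)]
      nlinarith [mul_le_mul_of_nonneg_left hy0 (sq_nonneg k)]
    have a2 : |2 * k * y 1| ≤ 30 * k ^ 3 := by
      rw [abs_mul, abs_of_nonneg (by linarith : 0 ≤ 2 * k)]
      nlinarith [mul_le_mul_of_nonneg_left hy1 (by linarith : 0 ≤ k)]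
    unfold planeSheet at h7 h8
    rw [abs_le] at a1 a2 ⊢
    constructor <;> linarith [a1.1, a1.2, a2.1, a2.2]
  have far {a b c : ℝ} (hab : |a - b| ≤ 5) (hb : |b| ≤ c) : |a| ≤ c + 5 := by
    have := abs_add_le (a - b) b
    rw [sub_add_cancel] at this
    linarith
  have hx0 : |x 0| ≤ 11 * k := (far (hd 0) hy0).trans (by linarith)
  have hx1 : |x 1| ≤ 20 * k ^ 2 := (far (hd 1) hy1).trans (by linarith)
  have hx2 : |x 2| ≤ 49 * k ^ 3 := (far (hd 2) hy2).trans (by linarith)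
  have hy0' : |y 0| ≤ 11 * k := hy0.trans (by linarith)
  have hy1' : |y 1| ≤ 20 * k ^ 2 := hy1.trans (by linarith [sq_nonneg k])
  have near {a b c d e : ℝ} (hab : |a - b| ≤ 5) (hcd : |c - d| ≤ e) (hbd : b = d) :
      |a - c| ≤ e + 5 := by
    rw [abs_le] at hab hcd ⊢
    constructor <;> linarith [hab.1, hab.2, hcd.1, hcd.2]
  have hdisc {ε : ℝ} (hε : |ε| = 1) (h : y 2 = discSheet ε k (y 0) (y 1)) :
      |x 2 - discSheet ε k (x 0) (x 1)| ≤ 1005 * k ^ 2 :=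
    (near (hd 2) (abs_discSheet_sub_le hk hx0 hy0' hx1 hy1' (hd 0) (hd 1) hε) h).trans
      (by linarith)
  have hplane {ε : ℝ} (hε : |ε| = 1) (h : y 2 = planeSheet ε k (y 0) (y 1)) :
      |x 2 - planeSheet ε k (x 0) (x 1)| ≤ 1005 * k ^ 2 :=
    (near (hd 2) (abs_planeSheet_sub_le hk (hd 0) (hd 1) hε) h).trans (by linarith)
  simp only [graphTube, Set.mem_union, Set.mem_ofPred_eq, sub_zero]
  rcases hyeq with h | h | h | h | h | h | h | h
  · exact .inl (.inl (.inl (.inl ⟨h ▸ hd 0, hx1, hx2⟩)))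
  · exact .inl (.inl (.inl (.inr ⟨h ▸ hd 0, hx1, hx2⟩)))
  · refine .inl (.inl (.inr (.inl ⟨hx0, ?_, hx2⟩)))
    have : |(4 * k * |x 0| - 9 * k ^ 2) - (4 * k * |y 0| - 9 * k ^ 2)| ≤ 20 * k := by
      rw [sub_sub_sub_cancel_right, ← mul_sub, abs_mul, abs_of_nonneg (by linarith : 0 ≤ 4 * k)]
      nlinarith [(abs_abs_sub_abs_le_abs_sub (x 0) (y 0)).trans (hd 0)]
    exact (near (hd 1) this h.symm).trans (by linarith)
  · refine .inl (.inl (.inr (.inr ⟨hx0, ?_, hx2⟩)))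
    have : |((1 / 3) * x 0 ^ 2 + 3 * k ^ 2) - ((1 / 3) * y 0 ^ 2 + 3 * k ^ 2)| ≤ 40 * k := by
      have := abs_le.1 (abs_sq_sub_sq_le hx0 hy0' (hd 0))
      rw [abs_le]
      constructor <;> linarith [this.1, this.2]
    exact (near (hd 1) this h).trans (by linarith)
  · exact .inl (.inr (.inl ⟨hx0, hx1, hdisc (by norm_num) h.symm⟩))
  · exact .inl (.inr (.inr ⟨hx0, hx1, hdisc (by norm_num) h⟩))
  · exact .inr (.inl ⟨hx0, hx1, hplane (by norm_num) h.symm⟩)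
  · exact .inr (.inr ⟨hx0, hx1, hplane (by norm_num) h⟩)

theorem boundary_neighborhood_volume :
    ∃ C : ℝ, 0 < C ∧ ∃ Q₀ : ℝ, 1 ≤ Q₀ ∧ ∀ q : ℝ, Q₀ ≤ q →
      volume (Metric.cthickening 4 (frontier (S3E q))) ≤
        ENNReal.ofReal (C * q ^ ((5 : ℝ) / 2)) := by
  refine ⟨16000000, by norm_num, 1, le_rfl, fun q hq => ?_⟩
  obtain ⟨k, hk, rfl⟩ : ∃ k : ℝ, 1 ≤ k ∧ q = k ^ 2 :=
    ⟨Real.sqrt q, Real.one_le_sqrt.2 hq, (Real.sq_sqrt (by linarith)).symm⟩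
  have hk0 : 0 ≤ k := by linarith
  have hk5 : 0 ≤ k ^ 5 := by positivity
  have union {A B : Set (EuclideanSpace ℝ (Fin 3))} {a b : ℝ} (ha : 0 ≤ a) (hb : 0 ≤ b)
      (hA : volume A ≤ ENNReal.ofReal (a * k ^ 5)) (hB : volume B ≤ ENNReal.ofReal (b * k ^ 5)) :
      volume (A ∪ B) ≤ ENNReal.ofReal ((a + b) * k ^ 5) := by
    rw [add_mul, ENNReal.ofReal_add (by positivity) (by positivity)]
    exact (measure_union_le A B).trans (add_le_add hA hB)
  have tube (a : ℝ) {g : ℝ → ℝ} {f : ℝ → ℝ → ℝ} (hg : Continuous g)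
      (hf : Continuous fun p : ℝ × ℝ => f p.1 p.2) {r₀ r₁ r₂ : ℝ}
      (h₁ : 0 ≤ r₁) (h₂ : 0 ≤ r₂) (h : 8 * r₀ * r₁ * r₂ ≤ 2000000 * k ^ 5) :
      volume (graphTube a g f r₀ r₁ r₂) ≤ ENNReal.ofReal (2000000 * k ^ 5) := by
    rw [volume_graphTube a hg.measurable hf.measurable h₁ h₂]
    exact ENNReal.ofReal_le_ofReal h
  have side (a : ℝ) := tube a (g := fun _ => 0) (f := fun _ _ => 0) (r₀ := 5) (r₁ := 20 * k ^ 2)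
    (r₂ := 49 * k ^ 3) continuous_const continuous_const (by positivity)
    (by positivity) (by nlinarith)
  have wall {g : ℝ → ℝ} (hg : Continuous g) := tube 0 (f := fun _ _ => 0) (r₀ := 11 * k)
    (r₁ := 45 * k) (r₂ := 49 * k ^ 3) hg continuous_const (by positivity)
    (by positivity) (by nlinarith)
  have sheet {f : ℝ → ℝ → ℝ} (hf : Continuous fun p : ℝ × ℝ => f p.1 p.2) :=
    tube 0 (g := fun _ => 0) (r₀ := 11 * k) (r₁ := 20 * k ^ 2) (r₂ := 1005 * k ^ 2)
    continuous_const hf (by positivity) (by positivity) (by nlinarith)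
  have hpow : (k ^ 2) ^ ((5 : ℝ) / 2) = k ^ 5 := mod_cast sq_rpow_half_eq hk0 5
  rw [hpow]
  refine (measure_mono (cthickening_frontier_S3E_sq_subset hk)).trans ?_
  refine (union (by norm_num) (by norm_num) (union (by norm_num) (by norm_num)
    (union (by norm_num) (by norm_num)
      (union (by norm_num) (by norm_num) (side _) (side _))
      (union (by norm_num) (by norm_num) (wall (by fun_prop)) (wall (by fun_prop))))
      (union (by norm_num) (by norm_num)
        (sheet (continuous_discSheet _ _)) (sheet (continuous_discSheet _ _))))
      (union (by norm_num) (by norm_num)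
        (sheet (continuous_planeSheet _ _)) (sheet (continuous_planeSheet _ _)))).trans_eq ?_
  norm_num
end

section
/- There exist constants c₁, c₂ > 0 and a real number Q₀ ≥ 1 such that for all real q ≥ Q₀, the number N(q) of integer triples (s,t,u) ∈ ℤ³ lying in S₃(q) satisfies c₁·q³ ≤ N(q) ≤ c₂·q³. -/
/-- The integer points of the box `[-x, x] × [-y, y] × [-z, z]`. -/
noncomputable def intBox (x y z : ℝ) : Finset (ℤ × ℤ × ℤ) :=
  Finset.Icc (-⌊x⌋) ⌊x⌋ ×ˢ (Finset.Icc (-⌊y⌋) ⌊y⌋ ×ˢ Finset.Icc (-⌊z⌋) ⌊z⌋)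

theorem mem_Icc_neg_floor_iff {x : ℝ} {n : ℤ} :
    n ∈ Finset.Icc (-⌊x⌋) ⌊x⌋ ↔ |(n : ℝ)| ≤ x := by
  rw [Finset.mem_Icc, neg_le, Int.le_floor, Int.le_floor, abs_le, Int.cast_neg, neg_le]

theorem mem_intBox_iff {x y z : ℝ} {p : ℤ × ℤ × ℤ} :
    p ∈ intBox x y z ↔ |(p.1 : ℝ)| ≤ x ∧ |(p.2.1 : ℝ)| ≤ y ∧ |(p.2.2 : ℝ)| ≤ z := by
  simp only [intBox, Finset.mem_product, mem_Icc_neg_floor_iff]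

theorem card_Icc_neg_floor {x : ℝ} (hx : 0 ≤ x) :
    ((Finset.Icc (-⌊x⌋) ⌊x⌋).card : ℝ) = 2 * (⌊x⌋ : ℝ) + 1 := by
  have h0 : 0 ≤ ⌊x⌋ := Int.floor_nonneg.2 hx
  have h : ((Finset.Icc (-⌊x⌋) ⌊x⌋).card : ℤ) = 2 * ⌊x⌋ + 1 := by
    rw [Int.card_Icc, Int.toNat_of_nonneg (by lia)]
    ring
  exact_mod_cast h

theorem le_card_Icc_neg_floor {x : ℝ} (hx : 0 ≤ x) :
    x ≤ ((Finset.Icc (-⌊x⌋) ⌊x⌋).card : ℝ) := by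
  rw [card_Icc_neg_floor hx]
  have h0 : (0 : ℝ) ≤ ⌊x⌋ := by exact_mod_cast Int.floor_nonneg.2 hx
  linarith [Int.lt_floor_add_one x]

theorem card_Icc_neg_floor_le {x : ℝ} (hx : 1 ≤ x) :
    ((Finset.Icc (-⌊x⌋) ⌊x⌋).card : ℝ) ≤ 3 * x := by
  rw [card_Icc_neg_floor (by linarith)]
  linarith [Int.floor_le x]

theorem le_card_intBox {x y z : ℝ} (hx : 0 ≤ x) (hy : 0 ≤ y) (hz : 0 ≤ z) :
    x * (y * z) ≤ ((intBox x y z).card : ℝ) := by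
  rw [intBox, Finset.card_product, Finset.card_product, Nat.cast_mul, Nat.cast_mul]
  gcongr <;> exact le_card_Icc_neg_floor ‹_›

theorem card_intBox_le {x y z : ℝ} (hx : 1 ≤ x) (hy : 1 ≤ y) (hz : 1 ≤ z) :
    ((intBox x y z).card : ℝ) ≤ 3 * x * (3 * y * (3 * z)) := by
  rw [intBox, Finset.card_product, Finset.card_product, Nat.cast_mul, Nat.cast_mul]
  gcongr <;> exact card_Icc_neg_floor_le ‹_›

theorem rpow_three_halves_s6 {x : ℝ} (hx : 0 ≤ x) : x ^ ((3 : ℝ) / 2) = √x ^ 3 := by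
  rw [Real.sqrt_eq_rpow, ← Real.rpow_natCast, ← Real.rpow_mul hx]
  norm_num

theorem S3_subset_box {q s t u : ℝ} (hq : 0 ≤ q) (h : (s, t, u) ∈ S3 q) :
    |s| ≤ 6 * √q ∧ |t| ≤ 15 * √q ^ 2 ∧ |u| ≤ 44 * √q ^ 3 := by
  obtain ⟨h1, h2, h3, h4, -, -, h5, h6⟩ := h
  dsimp only at h1 h2 h3 h4 h5 h6
  rw [rpow_three_halves_s6 hq] at h5 h6
  have hr : 0 ≤ √q := Real.sqrt_nonneg q
  have hrq : √q ^ 2 = q := Real.sq_sqrt hq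
  generalize √q = r at *
  subst hrq
  have hs : |s| ≤ 6 * r := abs_le.2 ⟨by linarith, h2⟩
  have hs2 : s ^ 2 ≤ (6 * r) ^ 2 := sq_le_sq' (by linarith) h2
  have ht1 : t ≤ 15 * r ^ 2 := by linarith
  have ht2 : -(9 * r ^ 2) ≤ t := by
    have : 0 ≤ 4 * r * |s| := by positivity
    linarith
  have hrt := mul_le_mul_of_nonneg_left ht1 hr
  have hrs := mul_le_mul_of_nonneg_left h1 (sq_nonneg r)
  have hrs' := mul_le_mul_of_nonneg_left h2 (sq_nonneg r)
  refine ⟨hs, abs_le.2 ⟨by linarith [sq_nonneg r], ht1⟩, abs_le.2 ⟨?_, ?_⟩⟩ <;> linarith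

theorem box_subset_S3 {q s t u : ℝ} (hq : 0 ≤ q) (hs : |s| ≤ √q / 10)
    (ht : |t| ≤ √q ^ 2 / 10) (hu : |u| ≤ √q ^ 3 / 10) : (s, t, u) ∈ S3 q := by
  have hr : 0 ≤ √q := Real.sqrt_nonneg q
  have hrq : √q ^ 2 = q := Real.sq_sqrt hq
  have hpow : 8 * √q ^ 3 ≤ (s ^ 2 - 3 * t + 9 * q) ^ ((3 : ℝ) / 2) := by
    have hle : 4 * q ≤ s ^ 2 - 3 * t + 9 * q := by
      linarith [sq_nonneg s, (abs_le.1 ht).2]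
    rw [rpow_three_halves_s6 (by linarith)]
    have h2 : 2 * √q ≤ √(s ^ 2 - 3 * t + 9 * q) := by
      apply Real.le_sqrt_of_sq_le
      linarith
    calc 8 * √q ^ 3 = (2 * √q) ^ 3 := by ring
      _ ≤ _ := by gcongr
  have h3 : |s ^ 3| ≤ √q ^ 3 / 1000 := by
    rw [abs_pow]
    calc |s| ^ 3 ≤ (√q / 10) ^ 3 := by gcongr
      _ = _ := by ring
  have hst : |s * t| ≤ √q ^ 3 / 100 := by
    rw [abs_mul]
    calc |s| * |t| ≤ (√q / 10) * (√q ^ 2 / 10) := by gcongr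
      _ = _ := by ring
  have hqs : |q * s| ≤ √q ^ 3 / 10 := by
    rw [abs_mul, abs_of_nonneg hq]
    calc q * |s| ≤ q * (√q / 10) := by gcongr
      _ = √q ^ 2 * (√q / 10) := by rw [hrq]
      _ = _ := by ring
  have hrt : |√q * t| ≤ √q ^ 3 / 10 := by
    rw [abs_mul, abs_of_nonneg hr]
    calc √q * |t| ≤ √q * (√q ^ 2 / 10) := by gcongr
      _ = _ := by ring
  have hrs : √q * |s| ≤ q / 10 := by
    calc √q * |s| ≤ √q * (√q / 10) := by gcongr
      _ = √q ^ 2 / 10 := by ring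
      _ = _ := by rw [hrq]
  have hr3 : 0 ≤ √q ^ 3 := by positivity
  rw [abs_le] at hs ht hu h3 hst hqs hrt
  refine ⟨?_, ?_, ?_, ?_, ?_, ?_, ?_, ?_⟩ <;> dsimp only <;>
    try rw [rpow_three_halves_s6 hq]
  all_goals linarith [sq_nonneg s]

theorem latticeCount_order_of_growth :
    ∃ c₁ : ℝ, 0 < c₁ ∧ ∃ c₂ : ℝ, 0 < c₂ ∧ ∃ Q₀ : ℝ, 1 ≤ Q₀ ∧
      ∀ q : ℝ, Q₀ ≤ q →
        c₁ * q ^ 3 ≤ (latticeCount q : ℝ) ∧ (latticeCount q : ℝ) ≤ c₂ * q ^ 3 := by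
  have key : ∀ q : ℝ, 1 ≤ q → √q ^ 6 = q ^ 3 := fun q hq => by
    rw [show √q ^ 6 = (√q ^ 2) ^ 3 by ring, Real.sq_sqrt (by linarith)]
  refine ⟨1 / 1000, by norm_num, 27 * (6 * 15 * 44), by norm_num, 1, le_rfl, fun q hq => ?_⟩
  have hq0 : 0 ≤ q := by linarith
  have hr : 1 ≤ √q := Real.one_le_sqrt.2 hq
  have hsub : {p : ℤ × ℤ × ℤ | ((p.1 : ℝ), ((p.2.1 : ℝ), (p.2.2 : ℝ))) ∈ S3 q} ⊆
      (intBox (6 * √q) (15 * √q ^ 2) (44 * √q ^ 3) : Set (ℤ × ℤ × ℤ)) := fun p hp =>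
    Finset.mem_coe.2 (mem_intBox_iff.2 (S3_subset_box hq0 hp))
  have hsup : (intBox (√q / 10) (√q ^ 2 / 10) (√q ^ 3 / 10) : Set (ℤ × ℤ × ℤ)) ⊆
      {p : ℤ × ℤ × ℤ | ((p.1 : ℝ), ((p.2.1 : ℝ), (p.2.2 : ℝ))) ∈ S3 q} := fun p hp => by
    obtain ⟨h1, h2, h3⟩ := mem_intBox_iff.1 (Finset.mem_coe.1 hp)
    exact box_subset_S3 hq0 h1 h2 h3
  have hlow := Set.ncard_le_ncard hsup ((Finset.finite_toSet _).subset hsub)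
  have hupp := Set.ncard_le_ncard hsub (Finset.finite_toSet _)
  rw [Set.ncard_coe_finset] at hlow hupp
  constructor
  · calc 1 / 1000 * q ^ 3 = √q / 10 * (√q ^ 2 / 10 * (√q ^ 3 / 10)) := by
          rw [← key q hq]; ring
      _ ≤ _ := le_card_intBox (by positivity) (by positivity) (by positivity)
      _ ≤ _ := Nat.cast_le.2 hlow
  · have hr2 : 1 ≤ √q ^ 2 := one_le_pow₀ hr
    have hr3 : 1 ≤ √q ^ 3 := one_le_pow₀ hr
    calc (latticeCount q : ℝ) ≤ _ := Nat.cast_le.2 hupp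
      _ ≤ _ := card_intBox_le (by linarith) (by linarith) (by linarith)
      _ = 27 * (6 * 15 * 44) * q ^ 3 := by rw [← key q hq]; ring
end

section
/- Let n ≥ 1 and g ≥ 0 be natural numbers, let F be the field with 2^n elements, and let v ∈ F[x] be a monic polynomial of degree at most g+1. Let V be the additive group of polynomials in F[x] of degree < 2g+3, and let U be the additive subgroup of V generated by the set {r·v + r² : r ∈ F[x], deg r < g+2} (in characteristic 2 this set is itself an additive subgroup). Then the quotient additive group V/U has exactly 2^{(g+1)·n + 1} elements. -/
/-- Over a ring of characteristic two, `r ↦ r * v + r ^ 2` is additive. -/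
noncomputable def mulAddSq {R : Type*} [CommRing R] [CharP R 2] (v : R) : R →+ R where
  toFun r := r * v + r ^ 2
  map_zero' := by simp
  map_add' a b := by rw [CharTwo.add_sq]; ring

theorem mulAddSq_eq_zero_iff {R : Type*} [CommRing R] [IsDomain R] [CharP R 2] (v r : R) :
    mulAddSq v r = 0 ↔ r = 0 ∨ r = v := by
  have h : mulAddSq v r = r * (r + v) := by
    change r * v + r ^ 2 = _
    ring
  rw [h, mul_eq_zero, CharTwo.add_eq_zero]

theorem Polynomial.natCard_degreeLT (K : Type*) [Field K] (m : ℕ) :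
    Nat.card (Polynomial.degreeLT K m) = Nat.card K ^ m := by
  rw [Nat.card_congr (Polynomial.degreeLTEquiv K m).toEquiv, Nat.card_fun, Nat.card_fin]

theorem Polynomial.mulAddSq_mem_degreeLT {K : Type*} [Field K] [CharP K 2] {g : ℕ}
    {v r : Polynomial K} (hv : v.natDegree ≤ g + 1)
    (hr : r ∈ Polynomial.degreeLT K (g + 2)) :
    mulAddSq v r ∈ Polynomial.degreeLT K (2 * g + 3) := by
  have hr' : r.natDegree ≤ g + 1 := by
    rcases eq_or_ne r 0 with rfl | h0
    · simp
    · exact Nat.lt_succ_iff.mp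
        ((Polynomial.natDegree_lt_iff_degree_lt h0).mpr (Polynomial.mem_degreeLT.mp hr))
  have h : (r * v + r ^ 2).natDegree ≤ 2 * g + 2 :=
    Polynomial.natDegree_add_le_of_degree_le
      (Polynomial.natDegree_mul_le.trans (by omega))
      (Polynomial.natDegree_pow_le.trans (by omega))
  rw [Polynomial.mem_degreeLT]
  refine (Polynomial.degree_le_of_natDegree_le h).trans_lt ?_
  exact_mod_cast Nat.lt_succ_self _

/-- The map `r ↦ r * v + r ^ 2` from polynomials of degree below `g + 2` to polynomials of degree
below `2 * g + 3`, for `v` of degree at most `g + 1`. -/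
noncomputable def Polynomial.degreeLTMulAddSq {K : Type*} [Field K] [CharP K 2] (g : ℕ)
    (v : Polynomial K) (hv : v.natDegree ≤ g + 1) :
    (Polynomial.degreeLT K (g + 2)).toAddSubgroup →+
      (Polynomial.degreeLT K (2 * g + 3)).toAddSubgroup :=
  ((mulAddSq v).comp (AddSubgroup.subtype _)).codRestrict _
    fun r => Polynomial.mulAddSq_mem_degreeLT hv r.2

theorem Polynomial.natCard_ker_degreeLTMulAddSq {K : Type*} [Field K] [CharP K 2] (g : ℕ)
    (v : Polynomial K) (hv : v.natDegree ≤ g + 1) (hv0 : v ≠ 0) :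
    Nat.card (Polynomial.degreeLTMulAddSq g v hv).ker = 2 := by
  have hvm : v ∈ (Polynomial.degreeLT K (g + 2)).toAddSubgroup := by
    change v ∈ Polynomial.degreeLT K (g + 2)
    rw [Polynomial.mem_degreeLT]
    refine (Polynomial.degree_le_of_natDegree_le hv).trans_lt ?_
    exact_mod_cast Nat.lt_succ_self _
  have h : ((Polynomial.degreeLTMulAddSq g v hv).ker :
      Set (Polynomial.degreeLT K (g + 2)).toAddSubgroup) = {0, ⟨v, hvm⟩} := by
    ext r
    rw [SetLike.mem_coe, AddMonoidHom.mem_ker, Set.mem_insert_iff, Set.mem_singleton_iff,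
      Subtype.ext_iff, Subtype.ext_iff, Subtype.ext_iff]
    exact mulAddSq_eq_zero_iff v r.1
  rw [← SetLike.coe_sort_coe, h, Nat.card_coe_set_eq, Set.ncard_pair]
  intro h0
  exact hv0 (congrArg Subtype.val h0).symm

theorem Polynomial.range_degreeLTMulAddSq {K : Type*} [Field K] [CharP K 2] (g : ℕ)
    (v : Polynomial K) (hv : v.natDegree ≤ g + 1) :
    (Polynomial.degreeLTMulAddSq g v hv).range =
      (AddSubgroup.closure
        {p : Polynomial K | ∃ r : Polynomial K, r.degree < (g + 2 : ℕ) ∧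
          p = r * v + r ^ 2}).addSubgroupOf
        (Polynomial.degreeLT K (2 * g + 3)).toAddSubgroup := by
  have hset : {p : Polynomial K | ∃ r : Polynomial K, r.degree < (g + 2 : ℕ) ∧
      p = r * v + r ^ 2} =
      ((Polynomial.degreeLT K (g + 2)).toAddSubgroup.map (mulAddSq v) : Set (Polynomial K)) := by
    ext p
    constructor
    · rintro ⟨r, hr, rfl⟩
      exact ⟨r, Polynomial.mem_degreeLT.mpr hr, rfl⟩
    · rintro ⟨r, hr, rfl⟩
      exact ⟨r, Polynomial.mem_degreeLT.mp hr, rfl⟩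
  rw [hset, AddSubgroup.closure_eq]
  ext p
  rw [AddSubgroup.mem_addSubgroupOf]
  constructor
  · rintro ⟨r, rfl⟩
    exact ⟨r.1, r.2, rfl⟩
  · rintro ⟨r, hr, h⟩
    exact ⟨⟨r, hr⟩, Subtype.ext h⟩

theorem card_quotient_V_by_U (n g : ℕ) (hn : 1 ≤ n)
    (v : Polynomial (GaloisField 2 n)) (hv : v.Monic) (hvdeg : v.natDegree ≤ g + 1) :
    Nat.card
      ((Polynomial.degreeLT (GaloisField 2 n) (2 * g + 3)).toAddSubgroup ⧸
        ((AddSubgroup.closure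
            {p : Polynomial (GaloisField 2 n) |
              ∃ r : Polynomial (GaloisField 2 n), r.degree < (g + 2 : ℕ) ∧
                p = r * v + r ^ 2}).addSubgroupOf
          (Polynomial.degreeLT (GaloisField 2 n) (2 * g + 3)).toAddSubgroup)) =
      2 ^ ((g + 1) * n + 1) := by
  rw [← Polynomial.range_degreeLTMulAddSq g v hvdeg]
  set f := Polynomial.degreeLTMulAddSq g v hvdeg
  have hcard (m : ℕ) :
      Nat.card (Polynomial.degreeLT (GaloisField 2 n) m).toAddSubgroup = 2 ^ (n * m) := by
    rw [pow_mul, ← GaloisField.card 2 n (by omega)]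
    exact Polynomial.natCard_degreeLT _ m
  have hdom := f.ker.card_mul_index
  rw [AddSubgroup.index_ker, Polynomial.natCard_ker_degreeLTMulAddSq g v hvdeg hv.ne_zero,
    hcard] at hdom
  have hcod := f.range.card_eq_card_quotient_mul_card_addSubgroup
  rw [hcard] at hcod
  have hpos : 0 < 2 ^ (n * (g + 2)) := by positivity
  refine Nat.eq_of_mul_eq_mul_right hpos ?_
  rw [← hdom, mul_left_comm, ← hcod, hdom, ← pow_succ', ← pow_add]
  congr 1
  ring
end

section
/- Fix a natural number g ≥ 2. There exists a constant C > 0 such that for every natural number n ≥ 1 with gcd(g+1, 2^n − 1) = 1, letting F be the field with 2^n elements, the sum over all monic polynomials f ∈ F[x] of degree at most g+1 of the number of matrices A ∈ GL₂(F) with ψ_{g+1}(A)(f) = f is at most C·2^{n(g+1)}. -/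
open Polynomial

/-- The twisted Möbius action of a 2×2 matrix on polynomials of degree at most `m`:
`ψ_m(A)(f) = Σ_{i=0}^{m} f_i (a x + b)^i (c x + d)^{m-i}`. -/
noncomputable def psi {F : Type*} [Field F] (m : ℕ) (A : Matrix (Fin 2) (Fin 2) F)
    (f : Polynomial F) : Polynomial F :=
  ∑ i ∈ Finset.range (m + 1),
    C (f.coeff i) * (C (A 0 0) * X + C (A 0 1)) ^ i *
      (C (A 1 0) * X + C (A 1 1)) ^ (m - i)

open OnePoint Matrix

section Counting

variable {F : Type*} [Field F] [Finite F]

lemma injOn_natDegree_coeff (F : Type*) [Field F] (k : ℕ) :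
    Set.InjOn (fun f : F[X] ↦ ((Fin.ofNat (k + 1) f.natDegree, fun i : Fin k ↦ f.coeff i) :
      Fin (k + 1) × (Fin k → F))) {f | f.Monic ∧ f.natDegree ≤ k} := by
  rintro f ⟨hf, hfk⟩ h ⟨hh, hhk⟩ heq
  simp only [Prod.mk.injEq, funext_iff, Fin.ext_iff, Fin.val_ofNat] at heq
  obtain ⟨hdeg, hcoeff⟩ := heq
  rw [Nat.mod_eq_of_lt (by omega), Nat.mod_eq_of_lt (by omega)] at hdeg
  ext i
  rcases lt_trichotomy i f.natDegree with hi | rfl | hi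
  · exact hcoeff ⟨i, by omega⟩
  · rw [hf.coeff_natDegree, hdeg, hh.coeff_natDegree]
  · rw [coeff_eq_zero_of_natDegree_lt hi, coeff_eq_zero_of_natDegree_lt (hdeg ▸ hi)]

variable (F) in
lemma finite_monic_natDegree_le (k : ℕ) : {f : F[X] | f.Monic ∧ f.natDegree ≤ k}.Finite :=
  Set.Finite.of_injOn (Set.mapsTo_univ _ _) (injOn_natDegree_coeff F k) Set.finite_univ

variable (F) in
/-- The monic polynomials of degree at most `k` over a finite field. -/
noncomputable def monicsLE (k : ℕ) : Finset F[X] := (finite_monic_natDegree_le F k).toFinset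

@[simp] lemma mem_monicsLE {k : ℕ} {f : F[X]} :
    f ∈ monicsLE F k ↔ f.Monic ∧ f.natDegree ≤ k := by
  simp [monicsLE]

lemma card_monicsLE_le (k : ℕ) : (monicsLE F k).card ≤ (k + 1) * Nat.card F ^ k := by
  cases nonempty_fintype F
  have h := Finset.card_le_card_of_injOn (s := monicsLE F k) (t := Finset.univ) _
    (fun _ _ ↦ Finset.mem_coe.2 (Finset.mem_univ _))
    (by simpa [monicsLE] using injOn_natDegree_coeff F k)
  simpa [Nat.card_eq_fintype_card] using h

variable {K : Type*} [Field K] [DecidableEq K] [Algebra F K] [IsAlgClosed K]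

lemma card_monicsLE_filter_roots_le (m : ℕ) (S : Finset K) :
    ((monicsLE F m).filter fun f ↦ (f.aroots K).toFinset = S).card ≤ (m + 1) ^ S.card := by
  have h := Finset.card_le_card_of_injOn
    (s := (monicsLE F m).filter fun f ↦ (f.aroots K).toFinset = S) (t := Finset.univ)
    (fun f (s : S) ↦ Fin.ofNat (m + 1) ((f.aroots K).count (s : K)))
    (fun _ _ ↦ Finset.mem_coe.2 (Finset.mem_univ _)) ?_
  · simpa using h
  intro f hf h hh heq
  simp only [Finset.coe_filter, mem_monicsLE, Set.mem_ofPred_eq] at hf hh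
  have hle (p : F[X]) (hp : p.natDegree ≤ m) (s : K) : (p.aroots K).count s < m + 1 := by
    have h1 := (p.map (algebraMap F K)).card_roots'
    rw [natDegree_map] at h1
    have h2 := Multiset.count_le_card s (p.aroots K)
    rw [aroots] at *
    omega
  have hroots : f.aroots K = h.aroots K := by
    ext s
    by_cases hs : s ∈ S
    · have := congrArg Fin.val (congrFun heq ⟨s, hs⟩)
      rwa [Fin.val_ofNat, Fin.val_ofNat, Nat.mod_eq_of_lt (hle _ hf.1.2 s),
        Nat.mod_eq_of_lt (hle _ hh.1.2 s)] at this
    · rw [Multiset.count_eq_zero_of_notMem, Multiset.count_eq_zero_of_notMem]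
      · rwa [← Multiset.mem_toFinset, hh.2]
      · rwa [← Multiset.mem_toFinset, hf.2]
  apply map_injective _ (algebraMap F K).injective
  rw [(IsAlgClosed.splits (f.map (algebraMap F K))).eq_prod_roots_of_monic (hf.1.1.map _),
    (IsAlgClosed.splits (h.map (algebraMap F K))).eq_prod_roots_of_monic (hh.1.1.map _)]
  exact congrArg (fun s ↦ (Multiset.map (fun a ↦ X - C a) s).prod) hroots

omit [Finite F] [IsAlgClosed K] in
lemma aroots_radical_toFinset [DecidableEq F] {f : F[X]} (hf : f ≠ 0) :
    ((normalize (UniqueFactorizationMonoid.radical f)).aroots K).toFinset =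
      (f.aroots K).toFinset := by
  have hrad : normalize (UniqueFactorizationMonoid.radical f) ≠ 0 := by simp
  ext s
  simp only [Multiset.mem_toFinset, mem_aroots, ne_eq, hf, hrad, not_false_eq_true, true_and]
  constructor
  · exact aeval_eq_zero_of_dvd_aeval_eq_zero
      (normalize_dvd_iff.2 UniqueFactorizationMonoid.radical_dvd_self)
  · intro h
    obtain ⟨n, hn⟩ := UniqueFactorizationMonoid.exists_dvd_radical_self_pow hf
    refine aeval_eq_zero_of_dvd_aeval_eq_zero (dvd_normalize_iff.2 dvd_rfl) ?_
    have := aeval_eq_zero_of_dvd_aeval_eq_zero hn h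
    rw [map_pow] at this
    exact eq_zero_of_pow_eq_zero this

lemma natDegree_radical [DecidableEq F] {f : F[X]} (hf : f ≠ 0) :
    (normalize (UniqueFactorizationMonoid.radical f)).natDegree =
      (f.aroots K).toFinset.card := by
  classical
  rw [← aroots_radical_toFinset hf]
  have hsep : (normalize (UniqueFactorizationMonoid.radical f)).Separable := by
    rw [PerfectField.separable_iff_squarefree]
    exact (normalize_associated _).squarefree_iff.2 UniqueFactorizationMonoid.squarefree_radical
  rw [← card_rootSet_eq_natDegree (K := K) hsep (IsAlgClosed.splits _)]
  exact Fintype.card_of_finset' _ fun s ↦ by simp [rootSet]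

variable (F K) in
lemma card_monicsLE_filter_card_roots_le (m k : ℕ) :
    ((monicsLE F m).filter fun f ↦ (f.aroots K).toFinset.card ≤ k).card ≤
      (m + 1) ^ k * ((k + 1) * Nat.card F ^ k) := by
  classical
  refine (Finset.card_le_mul_card_image
    (f := fun f : F[X] ↦ normalize (UniqueFactorizationMonoid.radical f)) _ ((m + 1) ^ k)
      ?_).trans (Nat.mul_le_mul_left _ ((Finset.card_le_card ?_).trans (card_monicsLE_le k)))
  · intro r hr
    obtain ⟨f₀, hf₀, rfl⟩ := Finset.mem_image.1 hr
    simp only [Finset.mem_filter, mem_monicsLE] at hf₀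
    refine (Finset.card_le_card ?_).trans
      ((card_monicsLE_filter_roots_le (F := F) m (f₀.aroots K).toFinset).trans
        (Nat.pow_le_pow_right (by omega) hf₀.2))
    intro f hf
    simp only [Finset.mem_filter, mem_monicsLE] at hf ⊢
    refine ⟨hf.1.1, ?_⟩
    rw [← aroots_radical_toFinset hf.1.1.1.ne_zero, hf.2,
      aroots_radical_toFinset hf₀.1.1.ne_zero]
  · intro r hr
    obtain ⟨f, hf, rfl⟩ := Finset.mem_image.1 hr
    simp only [Finset.mem_filter, mem_monicsLE] at hf ⊢
    exact ⟨monic_normalize UniqueFactorizationMonoid.radical_ne_zero,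
      (natDegree_radical (K := K) hf.1.1.ne_zero).trans_le hf.2⟩

end Counting

section Action

variable {F : Type*} [Field F]

/-- The value at `(u, v)` of the binary form of degree `m` whose dehomogenization is `f`. -/
noncomputable def formEval {K : Type*} [Field K] [Algebra F K] (m : ℕ) (f : F[X]) (u v : K) : K :=
  ∑ i ∈ Finset.range (m + 1), algebraMap F K (f.coeff i) * u ^ i * v ^ (m - i)

lemma psi_smul (m : ℕ) (t : F) (A : Matrix (Fin 2) (Fin 2) F) (f : F[X]) :
    psi m (t • A) f = C (t ^ m) * psi m A f := by
  simp only [psi, Matrix.smul_apply, smul_eq_mul, Finset.mul_sum, C_mul, mul_assoc, ← mul_add]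
  refine Finset.sum_congr rfl fun i hi ↦ ?_
  rw [mul_pow, mul_pow, ← Nat.add_sub_cancel' (Nat.le_of_lt_succ (Finset.mem_range.1 hi)),
    Nat.add_sub_cancel_left, pow_add, C_mul, C_pow, C_pow]
  ring

variable {K : Type*} [Field K] [Algebra F K]

lemma aeval_psi (m : ℕ) (A : Matrix (Fin 2) (Fin 2) F) (f : F[X]) (r : K) :
    aeval r (psi m A f) = formEval m f (algebraMap F K (A 0 0) * r + algebraMap F K (A 0 1))
      (algebraMap F K (A 1 0) * r + algebraMap F K (A 1 1)) := by
  simp [psi, formEval, map_sum]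

lemma coeff_psi (m : ℕ) (A : Matrix (Fin 2) (Fin 2) F) (f : F[X]) :
    algebraMap F K ((psi m A f).coeff m) =
      formEval m f (algebraMap F K (A 0 0)) (algebraMap F K (A 1 0)) := by
  have hlin (a b : F) : (C a * X + C b).natDegree ≤ 1 := natDegree_linear_le
  simp only [psi, formEval, finsetSum_coeff, map_sum]
  refine Finset.sum_congr rfl fun i hi ↦ ?_
  obtain ⟨j, rfl⟩ := Nat.exists_eq_add_of_le (Nat.le_of_lt_succ (Finset.mem_range.1 hi))
  rw [Nat.add_sub_cancel_left, mul_assoc, coeff_C_mul,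
    coeff_mul_add_eq_of_natDegree_le (natDegree_pow_le_of_le i (hlin _ _) |>.trans_eq (mul_one i))
      (natDegree_pow_le_of_le j (hlin _ _) |>.trans_eq (mul_one j))]
  have h1 := coeff_pow_of_natDegree_le (m := i) (hlin (A 0 0) (A 0 1))
  have h2 := coeff_pow_of_natDegree_le (m := j) (hlin (A 1 0) (A 1 1))
  rw [mul_one] at h1 h2
  rw [h1, h2]
  simp [mul_assoc]

lemma formEval_zero_right (m : ℕ) (f : F[X]) (u : K) :
    formEval m f u 0 = algebraMap F K (f.coeff m) * u ^ m := by
  rw [formEval, Finset.sum_range_succ, Finset.sum_eq_zero]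
  · simp
  · intro i hi
    rw [zero_pow (Nat.sub_ne_zero_of_lt (Finset.mem_range.1 hi)), mul_zero]

lemma formEval_of_ne_zero {m : ℕ} {f : F[X]} (hf : f.natDegree ≤ m) (u : K) {v : K} (hv : v ≠ 0) :
    formEval m f u v = v ^ m * aeval (u / v) f := by
  rw [formEval, aeval_eq_sum_range' (Nat.lt_succ_of_le hf), Finset.mul_sum]
  refine Finset.sum_congr rfl fun i hi ↦ ?_
  obtain ⟨j, rfl⟩ := Nat.exists_eq_add_of_le (Nat.le_of_lt_succ (Finset.mem_range.1 hi))
  rw [Nat.add_sub_cancel_left, Algebra.smul_def, pow_add, div_pow]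
  field_simp

variable [DecidableEq K]

variable (K) in
/-- The zeros in the projective line over `K` of the binary form of degree `m` with
dehomogenization `f`. -/
noncomputable def projZeros (m : ℕ) (f : F[X]) : Finset (OnePoint K) :=
  open Classical in
  (f.aroots K).toFinset.map ⟨(↑), OnePoint.coe_injective⟩ ∪ if f.coeff m = 0 then {∞} else ∅

lemma coe_mem_projZeros {m : ℕ} {f : F[X]} (hf : f ≠ 0) {r : K} :
    (r : OnePoint K) ∈ projZeros K m f ↔ aeval r f = 0 := by
  classical
  have h : (r : OnePoint K) ∉ (if f.coeff m = 0 then {∞} else ∅ : Finset (OnePoint K)) := by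
    split_ifs <;> simp
  rw [projZeros, Finset.mem_union, or_iff_left h]
  simp [hf]

lemma infty_mem_projZeros {m : ℕ} {f : F[X]} :
    (∞ : OnePoint K) ∈ projZeros K m f ↔ f.coeff m = 0 := by
  classical
  rw [projZeros, Finset.mem_union]
  split_ifs with h0 <;> simp [h0]

lemma card_roots_le_card_projZeros (m : ℕ) (f : F[X]) :
    (f.aroots K).toFinset.card ≤ (projZeros K m f).card := by
  classical
  rw [← Finset.card_map ⟨((↑) : K → OnePoint K), OnePoint.coe_injective⟩]
  exact Finset.card_le_card Finset.subset_union_left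

lemma card_projZeros_le {m : ℕ} {f : F[X]} (hf : f.Monic) (hfm : f.natDegree ≤ m) :
    (projZeros K m f).card ≤ m := by
  classical
  refine (Finset.card_union_le _ _).trans ?_
  rw [Finset.card_map]
  have h1 : (f.aroots K).toFinset.card ≤ f.natDegree := by
    refine (Multiset.toFinset_card_le _).trans ?_
    rw [← natDegree_map (algebraMap F K)]
    exact card_roots' _
  split_ifs with h
  · have : f.natDegree ≠ m := by
      rintro rfl
      rw [hf.coeff_natDegree] at h
      exact one_ne_zero h
    rw [Finset.card_singleton]
    omega
  · simpa using h1.trans hfm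

lemma smul_mem_projZeros {m : ℕ} {f : F[X]} (hf : f ≠ 0) (hfm : f.natDegree ≤ m)
    {A : GL (Fin 2) F} (hA : psi m (A : Matrix (Fin 2) (Fin 2) F) f = f) {p : OnePoint K}
    (hp : p ∈ projZeros K m f) : A.map (algebraMap F K) • p ∈ projZeros K m f := by
  cases p with
  | infty =>
    rw [infty_mem_projZeros] at hp
    have h := coeff_psi (K := K) m (A : Matrix (Fin 2) (Fin 2) F) f
    rw [hA, hp, map_zero] at h
    rw [smul_infty_eq_ite]
    simp only [Matrix.GeneralLinearGroup.map_apply]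
    split_ifs with h0
    · rwa [infty_mem_projZeros]
    · rw [coe_mem_projZeros hf]
      rw [formEval_of_ne_zero hfm _ h0] at h
      exact (mul_eq_zero.1 h.symm).resolve_left (pow_ne_zero _ h0)
  | coe r =>
    rw [coe_mem_projZeros hf] at hp
    have h := aeval_psi m (A : Matrix (Fin 2) (Fin 2) F) f r
    rw [hA, hp] at h
    rw [smul_some_eq_ite]
    simp only [Matrix.GeneralLinearGroup.map_apply]
    split_ifs with h0
    · rw [infty_mem_projZeros]
      rw [h0, formEval_zero_right] at h
      refine (algebraMap F K).injective ?_
      rw [map_zero]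
      refine (mul_eq_zero.1 h.symm).resolve_right (pow_ne_zero _ fun h1 ↦ ?_)
      have hdet := (A.map (algebraMap F K)).det_ne_zero
      rw [Matrix.det_fin_two] at hdet
      simp only [Matrix.GeneralLinearGroup.map_apply] at hdet
      grind
    · rw [coe_mem_projZeros hf]
      rw [formEval_of_ne_zero hfm _ h0] at h
      exact (mul_eq_zero.1 h.symm).resolve_left (pow_ne_zero _ h0)

/-- A Möbius transformation with three fixed points is trivial. -/
lemma eq_scalar_of_three_fixed {B : GL (Fin 2) K} {T : Finset (OnePoint K)} (hT : T.card = 3)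
    (hfix : ∀ p ∈ T, B • p = p) : B 1 0 = 0 ∧ B 0 1 = 0 ∧ B 0 0 = B 1 1 := by
  classical
  have hquad (r : K) (hr : (r : OnePoint K) ∈ T) :
      B 1 0 * r ^ 2 + (B 1 1 - B 0 0) * r - B 0 1 = 0 := by
    have h := hfix _ hr
    rw [← Matrix.GeneralLinearGroup.fixpointPolynomial_aeval_eq_zero_iff] at h
    simpa [Matrix.GeneralLinearGroup.fixpointPolynomial] using h
  have hinf (h : ∞ ∈ T) : B 1 0 = 0 := smul_infty_eq_self_iff.1 (hfix _ h)
  obtain ⟨x, y, z, hxy, hxz, hyz, rfl⟩ := Finset.card_eq_three.1 hT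
  simp only [Finset.mem_insert, Finset.mem_singleton] at hquad hinf
  cases x <;> cases y <;> cases z <;>
    simp_all only [ne_eq, OnePoint.coe_eq_coe, not_true_eq_false, OnePoint.coe_ne_infty,
      OnePoint.infty_ne_coe, not_false_eq_true, or_true, false_or, or_false,
      forall_eq_or_imp, forall_eq, forall_const] <;> grind

/-- Two stabilizing matrices agreeing at three points coincide when the field has no nontrivial
`m`-th roots of unity. -/
lemma eq_of_smul_eq_on_three [Finite F] {m : ℕ} (hm : m.Coprime (Nat.card F - 1)) {f : F[X]}
    (hf : f ≠ 0) {A B : GL (Fin 2) F} (hA : psi m (A : Matrix (Fin 2) (Fin 2) F) f = f)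
    (hB : psi m (B : Matrix (Fin 2) (Fin 2) F) f = f) {T : Finset (OnePoint K)}
    (hT : T.card = 3)
    (hAB : ∀ p ∈ T, A.map (algebraMap F K) • p = B.map (algebraMap F K) • p) : A = B := by
  have hfix : ∀ p ∈ T, ((B⁻¹ * A).map (algebraMap F K)) • p = p := fun p hp ↦ by
    rw [map_mul, map_inv, mul_smul, hAB p hp, inv_smul_smul]
  obtain ⟨h10, h01, hdiag⟩ := eq_scalar_of_three_fixed hT hfix
  simp only [Matrix.GeneralLinearGroup.map_apply, map_eq_zero,
    (algebraMap F K).injective.eq_iff] at h10 h01 hdiag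
  set D : GL (Fin 2) F := B⁻¹ * A with hD
  have hAD : A = B * D := by rw [hD, mul_inv_cancel_left]
  set t := D 0 0
  have hDt : (D : Matrix (Fin 2) (Fin 2) F) = t • 1 := by
    ext i j
    fin_cases i <;> fin_cases j <;> simp [h10, h01, ← hdiag, t]
  have ht0 : t ≠ 0 := by
    have := D.det_ne_zero
    rw [hDt] at this
    rintro h
    simp [h] at this
  have hAt : (A : Matrix (Fin 2) (Fin 2) F) = t • (B : Matrix (Fin 2) (Fin 2) F) := by
    rw [hAD, Units.val_mul, hDt, mul_smul_comm, mul_one]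
  have htm : t ^ m = 1 := by
    rw [hAt, psi_smul, hB] at hA
    exact C_injective (mul_right_cancel₀ hf (hA.trans (by simp)))
  have ht1 : t = 1 := by
    cases nonempty_fintype F
    have hq : t ^ (Nat.card F - 1) = 1 := by
      rw [Nat.card_eq_fintype_card]
      exact FiniteField.pow_card_sub_one_eq_one t ht0
    have := orderOf_dvd_of_pow_eq_one htm
    have h2 := orderOf_dvd_of_pow_eq_one hq
    exact orderOf_eq_one_iff.1 (Nat.eq_one_of_dvd_coprimes hm this h2)
  ext i j
  rw [hAt, ht1, one_smul]

instance [Finite F] : Finite (OnePoint F) := inferInstanceAs (Finite (Option F))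

variable (F K) in
/-- The `F`-rational points of the projective line over `K`. -/
noncomputable def rationalPoints [Finite F] : Finset (OnePoint K) :=
  (Set.finite_range (OnePoint.map (algebraMap F K))).toFinset

omit [DecidableEq K] in
lemma card_rationalPoints [Finite F] : (rationalPoints F K).card = Nat.card F + 1 := by
  rw [rationalPoints, ← Set.ncard_eq_toFinset_card _ (Set.finite_range _), ← Set.image_univ,
    Set.ncard_image_of_injective, Set.ncard_univ]
  · exact Finite.card_option
  · exact Option.map_injective (algebraMap F K).injective

lemma smul_mem_rationalPoints [Finite F] (A : GL (Fin 2) F) {p : OnePoint K}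
    (hp : p ∈ rationalPoints F K) : A.map (algebraMap F K) • p ∈ rationalPoints F K := by
  classical
  rw [rationalPoints, Set.Finite.mem_toFinset] at hp ⊢
  obtain ⟨c, rfl⟩ := hp
  exact ⟨A • c, OnePoint.map_smul _ _ _⟩

variable (K) in
lemma card_stabilizer_le [Finite F] {m : ℕ} (hm : m.Coprime (Nat.card F - 1)) {f : F[X]}
    (hf : f.Monic) (hfm : f.natDegree ≤ m) :
    Nat.card {A : GL (Fin 2) F // psi m (A : Matrix (Fin 2) (Fin 2) F) f = f} ≤
      (m + 1) ^ 3 * (Nat.card F + 1) ^ (3 - (projZeros K m f).card) := by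
  classical
  set Z := projZeros K m f with hZ
  have hR := card_rationalPoints (F := F) (K := K)
  set R := rationalPoints F K
  obtain ⟨T, hT, hTsub, hTcard⟩ : ∃ T : Finset (OnePoint K), T.card = 3 ∧ T ⊆ Z ∪ R ∧
      (T \ Z).card = 3 - Z.card := by
    by_cases h : Z.card ≤ 3
    · have h3 : 3 ≤ (Z ∪ R).card := by
        have := Finset.card_le_card (Finset.subset_union_right (s₁ := Z) (s₂ := R))
        have := Finite.one_lt_card (α := F)
        omega
      obtain ⟨T, hZT, hTR, hT⟩ := Finset.exists_subsuperset_card_eq Finset.subset_union_left h h3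
      exact ⟨T, hT, hTR, by rw [Finset.card_sdiff_of_subset hZT, hT]⟩
    · obtain ⟨T, hTZ, hT⟩ := Finset.exists_subset_card_eq (le_of_not_ge h)
      refine ⟨T, hT, hTZ.trans Finset.subset_union_left, ?_⟩
      rw [Finset.sdiff_eq_empty_iff_subset.2 hTZ, Finset.card_empty]
      omega
  let S (p : OnePoint K) : Finset (OnePoint K) := if p ∈ Z then Z else R
  have hmap (A : {A : GL (Fin 2) F // psi m (A : Matrix (Fin 2) (Fin 2) F) f = f})
      (p : OnePoint K) (hp : p ∈ T) : A.1.map (algebraMap F K) • p ∈ S p := by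
    by_cases h : p ∈ Z
    · simpa [S, h] using smul_mem_projZeros hf.ne_zero hfm A.2 h
    · simpa [S, h] using smul_mem_rationalPoints A.1
        ((Finset.mem_union.1 (hTsub hp)).resolve_left h)
  have hcard := Nat.card_le_card_of_injective
    (fun A : {A : GL (Fin 2) F // psi m (A : Matrix (Fin 2) (Fin 2) F) f = f} ↦
      fun p : T ↦ (⟨A.1.map (algebraMap F K) • p.1, hmap A p.1 p.2⟩ : S p.1))
    fun A B hAB ↦ Subtype.ext <| eq_of_smul_eq_on_three (K := K) hm hf.ne_zero A.2 B.2 hT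
      fun p hp ↦ congrArg Subtype.val (congrFun hAB ⟨p, hp⟩)
  refine hcard.trans ?_
  rw [Nat.card_pi]
  simp only [Nat.card_eq_fintype_card, Fintype.card_coe]
  rw [Finset.prod_coe_sort T fun p ↦ (S p).card]
  simp only [S, apply_ite Finset.card]
  rw [Finset.prod_ite, Finset.prod_const, Finset.prod_const, Finset.filter_notMem_eq_sdiff,
    hTcard, hR]
  refine Nat.mul_le_mul_right _ ?_
  refine (Nat.pow_le_pow_left ((card_projZeros_le hf hfm).trans m.le_succ) _).trans ?_
  exact Nat.pow_le_pow_right m.succ_pos ((Finset.card_filter_le _ _).trans_eq hT)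

end Action

lemma sum_card_stabilizer_le {F : Type*} [Field F] [Finite F] {m : ℕ} (hm3 : 3 ≤ m)
    (hm : m.Coprime (Nat.card F - 1)) :
    ∑ f ∈ monicsLE F m,
        Nat.card {A : GL (Fin 2) F // psi m (A : Matrix (Fin 2) (Fin 2) F) f = f} ≤
      8 * (m + 1) ^ (m + 5) * Nat.card F ^ m := by
  classical
  let K := AlgebraicClosure F
  set q := Nat.card F
  have hq : 1 ≤ q := Nat.card_pos
  have hmaps : ∀ f ∈ monicsLE F m, (projZeros K m f).card ∈ Finset.range (m + 1) := fun f hf ↦ by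
    rw [mem_monicsLE] at hf
    exact Finset.mem_range.2 (Nat.lt_succ_of_le (card_projZeros_le hf.1 hf.2))
  rw [← Finset.sum_fiberwise_of_maps_to hmaps]
  have hfiber : ∀ k ∈ Finset.range (m + 1),
      ∑ f ∈ monicsLE F m with (projZeros K m f).card = k,
        Nat.card {A : GL (Fin 2) F // psi m (A : Matrix (Fin 2) (Fin 2) F) f = f} ≤
      8 * (m + 1) ^ (m + 4) * q ^ m := by
    intro k hk
    rw [Finset.mem_range] at hk
    have hcard : ((monicsLE F m).filter fun f ↦ (projZeros K m f).card = k).card ≤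
        (m + 1) ^ k * ((k + 1) * q ^ k) :=
      (Finset.card_le_card (Finset.monotone_filter_right _ fun f _ hf ↦
        (card_roots_le_card_projZeros m f).trans_eq hf)).trans
        (card_monicsLE_filter_card_roots_le F K m k)
    have hstab : (q + 1) ^ (3 - k) ≤ 8 * q ^ (3 - k) := by
      calc (q + 1) ^ (3 - k) ≤ (2 * q) ^ (3 - k) := Nat.pow_le_pow_left (by omega) _
        _ = 2 ^ (3 - k) * q ^ (3 - k) := mul_pow _ _ _
        _ ≤ 2 ^ 3 * q ^ (3 - k) :=
          Nat.mul_le_mul_right _ (Nat.pow_le_pow_right two_pos (Nat.sub_le _ _))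
    calc _ ≤ ∑ f ∈ monicsLE F m with (projZeros K m f).card = k,
          (m + 1) ^ 3 * (q + 1) ^ (3 - k) := by
            refine Finset.sum_le_sum fun f hf ↦ ?_
            rw [Finset.mem_filter, mem_monicsLE] at hf
            rw [← hf.2]
            exact card_stabilizer_le K hm hf.1.1 hf.1.2
      _ ≤ (m + 1) ^ k * ((k + 1) * q ^ k) * ((m + 1) ^ 3 * (8 * q ^ (3 - k))) := by
            rw [Finset.sum_const, smul_eq_mul]
            gcongr
      _ = 8 * ((m + 1) ^ k * (k + 1) * (m + 1) ^ 3) * q ^ (k + (3 - k)) := by ring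
      _ ≤ 8 * ((m + 1) ^ m * (m + 1) * (m + 1) ^ 3) * q ^ m := by
            gcongr <;> omega
      _ = 8 * (m + 1) ^ (m + 4) * q ^ m := by ring
  refine (Finset.sum_le_sum hfiber).trans_eq ?_
  rw [Finset.sum_const, Finset.card_range, smul_eq_mul]
  ring

theorem sum_stabilizer_sizes_bound (g : ℕ) (hg : 2 ≤ g) :
    ∃ C : ℝ, 0 < C ∧ ∀ n : ℕ, 1 ≤ n → Nat.gcd (g + 1) (2 ^ n - 1) = 1 →
      ∑ᶠ f ∈ {f : Polynomial (GaloisField 2 n) | f.Monic ∧ f.natDegree ≤ g + 1},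
          (Nat.card {A : GL (Fin 2) (GaloisField 2 n) //
            psi (g + 1) (A : Matrix (Fin 2) (Fin 2) (GaloisField 2 n)) f = f} : ℝ) ≤
        C * 2 ^ (n * (g + 1)) := by
  refine ⟨8 * (g + 2) ^ (g + 6), by positivity, fun n hn hgcd ↦ ?_⟩
  have hcard : Nat.card (GaloisField 2 n) = 2 ^ n := GaloisField.card 2 n (by omega)
  have : Finite (GaloisField 2 n) := Nat.finite_of_card_ne_zero (by rw [hcard]; positivity)
  have h := sum_card_stabilizer_le (F := GaloisField 2 n) (m := g + 1) (by omega)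
    (by rwa [hcard])
  rw [hcard, ← pow_mul] at h
  rw [finsum_mem_eq_finite_toFinset_sum _ (finite_monic_natDegree_le (GaloisField 2 n) (g + 1))]
  exact_mod_cast h
end

section
/- Let F be a field, m₁, m₂ natural numbers, A a 2×2 matrix over F, and f, g ∈ F[x] with deg f ≤ m₁ and deg g ≤ m₂. Then ψ_{m₁+m₂}(A)(f·g) = ψ_{m₁}(A)(f) · ψ_{m₂}(A)(g). -/
open Polynomial

theorem psi_eq_aeval_homogenize {F : Type*} [Field F] (m : ℕ) (A : Matrix (Fin 2) (Fin 2) F)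
    (f : Polynomial F) :
    psi m A f =
      MvPolynomial.aeval (fun i => C (A i 0) * X + C (A i 1)) (f.homogenize m) := by
  simp [psi, homogenize, MvPolynomial.aeval_monomial,
    Finset.Nat.sum_antidiagonal_eq_sum_range_succ_mk, Finsupp.prod_fintype, mul_assoc]

theorem psi_mul {F : Type*} [Field F] (m₁ m₂ : ℕ) (A : Matrix (Fin 2) (Fin 2) F)
    (f g : Polynomial F) (hf : f.degree ≤ (m₁ : ℕ)) (hg : g.degree ≤ (m₂ : ℕ)) :
    psi (m₁ + m₂) A (f * g) = psi m₁ A f * psi m₂ A g := by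
  rw [psi_eq_aeval_homogenize, psi_eq_aeval_homogenize, psi_eq_aeval_homogenize,
    homogenize_mul f g (natDegree_le_of_degree_le hf) (natDegree_le_of_degree_le hg), map_mul]
end

section
/- Let F be a field of characteristic 2, g a natural number, A a 2×2 matrix over F, and let v, r ∈ F[x] have degree at most g+1. If ψ_{g+1}(A)(v) = v, then ψ_{2g+2}(A)(r·v + r²) = r'·v + r'², where r' = ψ_{g+1}(A)(r). In particular, every matrix stabilizing v maps the set {r·v + r² : deg r ≤ g+1} into itself. -/
open Polynomial

section

variable {F : Type*} [Field F]

theorem psi_add (m : ℕ) (A : Matrix (Fin 2) (Fin 2) F) (f h : F[X]) :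
    psi m A (f + h) = psi m A f + psi m A h := by
  simp only [psi, coeff_add, C_add, add_mul, Finset.sum_add_distrib]

theorem psi_sum {ι : Type*} (m : ℕ) (A : Matrix (Fin 2) (Fin 2) F) (s : Finset ι)
    (f : ι → F[X]) : psi m A (∑ i ∈ s, f i) = ∑ i ∈ s, psi m A (f i) := by
  simp only [psi, finsetSum_coeff, map_sum, Finset.sum_mul]
  exact Finset.sum_comm

theorem psi_C_mul_X_pow {m i : ℕ} (hi : i ≤ m) (A : Matrix (Fin 2) (Fin 2) F) (a : F) :
    psi m A (C a * X ^ i) =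
      C a * (C (A 0 0) * X + C (A 0 1)) ^ i * (C (A 1 0) * X + C (A 1 1)) ^ (m - i) := by
  rw [psi, Finset.sum_eq_single i]
  · simp
  · intro j _ hj
    simp [coeff_X_pow, hj]
  · intro h
    exact absurd (Finset.mem_range.2 (Nat.lt_succ_of_le hi)) h

/-- The twisted Möbius action is multiplicative with respect to the degree bounds. -/
theorem psi_mul_s15 {m n : ℕ} (A : Matrix (Fin 2) (Fin 2) F) {f h : F[X]}
    (hf : f.degree ≤ m) (hh : h.degree ≤ n) :
    psi (m + n) A (f * h) = psi m A f * psi n A h := by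
  have hf' := f.as_sum_range_C_mul_X_pow' (Nat.lt_succ_of_le (natDegree_le_of_degree_le hf))
  have hh' := h.as_sum_range_C_mul_X_pow' (Nat.lt_succ_of_le (natDegree_le_of_degree_le hh))
  conv_lhs => rw [hf', hh', Finset.sum_mul_sum, psi_sum]
  rw [psi, psi, Finset.sum_mul_sum]
  refine Finset.sum_congr rfl fun i hi => ?_
  rw [psi_sum]
  refine Finset.sum_congr rfl fun j hj => ?_
  have hi' : i ≤ m := Nat.le_of_lt_succ (Finset.mem_range.1 hi)
  have hj' : j ≤ n := Nat.le_of_lt_succ (Finset.mem_range.1 hj)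
  have hmul : C (f.coeff i) * X ^ i * (C (h.coeff j) * X ^ j) =
      C (f.coeff i * h.coeff j) * X ^ (i + j) := by
    rw [C_mul, pow_add]
    ring
  rw [hmul, psi_C_mul_X_pow (add_le_add hi' hj'), C_mul,
    show m + n - (i + j) = (m - i) + (n - j) by omega, pow_add, pow_add]
  ring

theorem degree_psi_le (m : ℕ) (A : Matrix (Fin 2) (Fin 2) F) (f : F[X]) :
    (psi m A f).degree ≤ m := by
  refine degree_le_of_natDegree_le (natDegree_sum_le_of_forall_le _ _ fun i hi => ?_)
  have hi' : i ≤ m := Nat.le_of_lt_succ (Finset.mem_range.1 hi)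
  have h₁ := natDegree_pow_le_of_le i (natDegree_linear_le (a := A 0 0) (b := A 0 1))
  have h₂ := natDegree_pow_le_of_le (m - i) (natDegree_linear_le (a := A 1 0) (b := A 1 1))
  refine (natDegree_mul_le_of_le ((natDegree_C_mul_le _ _).trans h₁) h₂).trans ?_
  omega

theorem psi_mul_add_sq_of_psi_eq {m : ℕ} (A : Matrix (Fin 2) (Fin 2) F) {v r : F[X]}
    (hv : v.degree ≤ m) (hr : r.degree ≤ m) (hstab : psi m A v = v) :
    psi (m + m) A (r * v + r ^ 2) = psi m A r * v + psi m A r ^ 2 := by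
  rw [psi_add, psi_mul_s15 A hr hv, hstab, sq, psi_mul_s15 A hr hr, sq]

end

theorem psi_stabilizer_preserves_artin_schreier_set {F : Type*} [Field F] [CharP F 2]
    (g : ℕ) (A : Matrix (Fin 2) (Fin 2) F) (v r : Polynomial F)
    (hv : v.degree ≤ (g + 1 : ℕ)) (hr : r.degree ≤ (g + 1 : ℕ))
    (hstab : psi (g + 1) A v = v) :
    psi (2 * g + 2) A (r * v + r ^ 2) =
        psi (g + 1) A r * v + (psi (g + 1) A r) ^ 2 ∧
      ∀ p ∈ {p : Polynomial F | ∃ r' : Polynomial F, r'.degree ≤ (g + 1 : ℕ) ∧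
          p = r' * v + r' ^ 2},
        psi (2 * g + 2) A p ∈ {p : Polynomial F | ∃ r' : Polynomial F,
          r'.degree ≤ (g + 1 : ℕ) ∧ p = r' * v + r' ^ 2} := by
  have key : ∀ q : F[X], q.degree ≤ (g + 1 : ℕ) →
      psi (2 * g + 2) A (q * v + q ^ 2) = psi (g + 1) A q * v + psi (g + 1) A q ^ 2 := by
    intro q hq
    rw [show 2 * g + 2 = (g + 1) + (g + 1) by ring]
    exact psi_mul_add_sq_of_psi_eq A hv hq hstab
  refine ⟨key r hr, ?_⟩
  rintro _ ⟨q, hq, rfl⟩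
  exact ⟨psi (g + 1) A q, degree_psi_le _ _ _, key q hq⟩
end
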